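/- arXiv:2104.13811 — 2 statements merged into one kernel-verified Lean document; each statement's English description precedes it below -/
import Mathlib

section
/- Let K be a field, let R be a polynomial ring over K in finitely many indeterminates, let m, n be integers with 1 ≤ m ≤ n, let X be a generic m×n matrix over R, and set B = R[X] and J = I_m(X). Then the supremum over all positive integers k of the projective dimension pd_B(J^k) equals m(n−m). -/
open Matrix

/-- The ideal generated by the `t × t` minors of a matrix. -/
noncomputable def minorsIdeal {R : Type*} [CommRing R] {α β : Type*}
    (t : ℕ) (A : Matrix α β R) : Ideal R :=
  Ideal.span {d : R | ∃ (f : Fin t → α) (g : Fin t → β),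
    Function.Injective f ∧ Function.Injective g ∧ d = (A.submatrix f g).det}

/-- The height of an ideal: the infimum of the heights of primes containing it. -/
noncomputable def idealHeight {R : Type*} [CommRing R] (I : Ideal R) : ℕ∞ :=
  ⨅ p ∈ {p : PrimeSpectrum R | I ≤ p.asIdeal}, Order.height p

/-- The minimal number of generators of an ideal. -/
noncomputable def mu {R : Type*} [CommRing R] (I : Ideal R) : ℕ :=
  sInf {n : ℕ | ∃ s : Finset R, s.card = n ∧ Ideal.span (s : Set R) = I}

/-- The condition `G_s`. -/
def SatisfiesG {R : Type*} [CommRing R] (I : Ideal R) (s : ℕ) : Prop :=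
  ∀ (p : Ideal R) (hp : p.IsPrime), I ≤ p →
    haveI := hp
    ringKrullDim (Localization.AtPrime p) ≤ ((s - 1 : ℕ) : WithBot ℕ∞) →
    (mu (I.map (algebraMap R (Localization.AtPrime p))) : WithBot ℕ∞) ≤
      ringKrullDim (Localization.AtPrime p)

/-- `pdim R M` is the projective dimension of the `R`-module `M`, as an element of `ℕ∞`
(it is `⊤` if `M` has no finite projective resolution). -/
noncomputable def pdim (R : Type*) [Ring R] (M : Type*) [AddCommGroup M] [Module R M] : ℕ∞ :=
  sInf {n : ℕ∞ | ∃ m : ℕ, n = m ∧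
    ∃ P : CategoryTheory.ProjectiveResolution (ModuleCat.of R M),
      ∀ i : ℕ, m < i → CategoryTheory.Limits.IsZero (P.complex.X i)}

section Resolutions

open CategoryTheory CategoryTheory.Limits

universe v₁ u₁

variable {C : Type u₁} [Category.{v₁} C] [Abelian C]

/-- A projective resolution of the kernel of an epimorphism from a projective object extends to a
projective resolution of the target, one step longer. -/
theorem CategoryTheory.ShortComplex.ShortExact.exists_projectiveResolution {S : ShortComplex C}
    (hS : S.ShortExact) [Projective S.X₂] {d : ℕ} (P : ProjectiveResolution S.X₁)
    (hP : ∀ i, d < i → IsZero (P.complex.X i)) :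
    ∃ Q : ProjectiveResolution S.X₃, ∀ i, d + 1 < i → IsZero (Q.complex.X i) := by
  have := hS.mono_f
  have := hS.epi_g
  obtain ⟨e, he, hexact, hepi⟩ : ∃ (e : P.complex.X 0 ⟶ S.X₁) (he : P.complex.d 1 0 ≫ e = 0),
      (ShortComplex.mk _ e he).Exact ∧ Epi e :=
    ⟨P.π.f 0, P.complex_d_comp_π_f_zero,
      ShortComplex.exact_of_g_is_cokernel _ P.isColimitCokernelCofork,
      inferInstanceAs (Epi (((P.π.f 0)) : P.complex.X 0 ⟶ ((ChainComplex.single₀ C).obj S.X₁).X 0))⟩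
  let A : ChainComplex C ℕ := ChainComplex.augment P.complex (e ≫ S.f)
    (by rw [← Category.assoc, he, zero_comp])
  have hA : ∀ n, A.ExactAt (n + 1) := by
    intro n
    rw [HomologicalComplex.exactAt_iff' _ (n + 1 + 1) (n + 1) n (by simp) (by simp)]
    match n with
    | 0 =>
      let φ : ShortComplex.mk _ e he ⟶ A.sc' 2 1 0 :=
        { τ₁ := 𝟙 _, τ₂ := 𝟙 _, τ₃ := S.f
          comm₁₂ := (Category.id_comp _).trans (Category.comp_id _).symm
          comm₂₃ := Category.id_comp _ }
      have : Epi φ.τ₁ := inferInstanceAs (Epi (𝟙 _))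
      have : IsIso φ.τ₂ := inferInstanceAs (IsIso (𝟙 _))
      have : Mono φ.τ₃ := inferInstanceAs (Mono S.f)
      exact (ShortComplex.exact_iff_of_epi_of_isIso_of_mono φ).1 hexact
    | n + 1 => exact P.exact_succ n
  have hzero : A.d 1 0 ≫ S.g = 0 := by
    change (e ≫ S.f) ≫ S.g = 0
    rw [Category.assoc, S.zero, comp_zero]
  have hA₀ : (ShortComplex.mk _ _ hzero).Exact := by
    let φ : ShortComplex.mk _ _ hzero ⟶ S :=
      { τ₁ := e, τ₂ := 𝟙 _, τ₃ := 𝟙 _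
        comm₁₂ := (Category.comp_id _).symm
        comm₂₃ := (Category.id_comp _).trans (Category.comp_id _).symm }
    have : Epi φ.τ₁ := hepi
    have : IsIso φ.τ₂ := inferInstanceAs (IsIso (𝟙 _))
    have : Mono φ.τ₃ := inferInstanceAs (Mono (𝟙 _))
    exact (ShortComplex.exact_iff_of_epi_of_isIso_of_mono φ).2 hS.exact
  have toSingle_f_zero : ∀ (A : ChainComplex C ℕ) (Y : C) (g : A.X 0 ⟶ Y) (h : A.d 1 0 ≫ g = 0),
      ((ChainComplex.toSingle₀Equiv A Y).symm ⟨g, h⟩).f 0 = g :=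
    fun A Y g h => ChainComplex.toSingle₀Equiv_symm_apply_f_zero g h
  refine ⟨{ complex := A
            projective := ?_
            π := (ChainComplex.toSingle₀Equiv _ _).symm ⟨S.g, hzero⟩
            quasiIso := ⟨fun n => ?_⟩ }, ?_⟩
  · rintro (_ | n)
    · exact inferInstanceAs (Projective S.X₂)
    · exact P.projective n
  · cases n
    · rw [ChainComplex.quasiIsoAt₀_iff, ShortComplex.quasiIso_iff_of_zeros']
      · refine (ShortComplex.exact_and_epi_g_iff_of_iso ?_).2 ⟨hA₀, hS.epi_g⟩
        exact ShortComplex.isoMk (Iso.refl _) (Iso.refl _) (Iso.refl _)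
          ((Category.id_comp _).trans (Category.comp_id _).symm)
          ((Category.id_comp _).trans ((Category.comp_id _).trans (toSingle_f_zero A S.X₃ S.g hzero)).symm)
      all_goals rfl
    · rw [quasiIsoAt_iff_exactAt']
      · apply hA
      · apply ChainComplex.exactAt_succ_single_obj
  · rintro (_ | i) hi
    · omega
    · exact hP i (by omega)

theorem CategoryTheory.ProjectiveResolution.hasProjectiveDimensionLE {X : C} (d : ℕ)
    (P : ProjectiveResolution X) (hP : ∀ i, d < i → IsZero (P.complex.X i)) :
    HasProjectiveDimensionLE X d := by
  let := HasExt.standard C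
  rw [HasProjectiveDimensionLE, hasProjectiveDimensionLT_iff]
  intro i hi Y e
  obtain ⟨f, hf, rfl⟩ := P.extMk_surjective e (i + 1) rfl
  obtain rfl : f = 0 := (hP i (by omega)).eq_of_src _ _
  exact P.extMk_zero _ _

variable [EnoughProjectives C]

theorem exists_projectiveResolution_of_hasProjectiveDimensionLE (d : ℕ) (X : C)
    [h : HasProjectiveDimensionLE X d] :
    ∃ P : ProjectiveResolution X, ∀ i, d < i → IsZero (P.complex.X i) := by
  induction d generalizing X with
  | zero =>
    have : Projective X := (projective_iff_hasProjectiveDimensionLE_zero X).2 h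
    refine ⟨ProjectiveResolution.self X, fun i hi => ?_⟩
    exact HomologicalComplex.isZero_single_obj_X _ _ _ _ (by omega)
  | succ d ih =>
    obtain ⟨⟨P, f⟩⟩ := EnoughProjectives.presentation X
    let T := ShortComplex.mk (kernel.ι f) f (kernel.condition f)
    have hT : T.ShortExact := { exact := ShortComplex.exact_kernel f }
    have hP : Projective T.X₂ := ‹_›
    have := (hT.hasProjectiveDimensionLT_X₃_iff d ‹_›).mp h
    obtain ⟨P, hP⟩ := ih T.X₁ (h := this)
    exact hT.exists_projectiveResolution P hP

end Resolutions

section BaseChange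

open CategoryTheory TensorProduct

universe u

theorem ModuleCat.hasProjectiveDimensionLE_baseChange {A B : Type u} [CommRing A] [CommRing B]
    [Algebra A B] [Module.Flat A B] (d : ℕ) (M : Type u) [AddCommGroup M] [Module A M]
    (h : HasProjectiveDimensionLE (ModuleCat.of A M) d) :
    HasProjectiveDimensionLE (ModuleCat.of B (B ⊗[A] M)) d := by
  induction d generalizing M with
  | zero =>
    rw [← projective_iff_hasProjectiveDimensionLE_zero, ← IsProjective.iff_projective] at h ⊢
    have : Module.Projective A M := h
    exact inferInstanceAs (Module.Projective B (B ⊗[A] M))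
  | succ d ih =>
    obtain ⟨P, _, _, _, f, hf⟩ : ∃ (P : Type u) (_ : AddCommGroup P) (_ : Module A P)
        (_ : Module.Projective A P) (f : P →ₗ[A] M), Function.Surjective f :=
      ⟨M →₀ A, inferInstance, inferInstance, inferInstance, _,
        Finsupp.linearCombination_id_surjective A M⟩
    have hS := LinearMap.shortExact_shortComplexKer hf
    have hproj : Projective f.shortComplexKer.X₂ := by
      rw [← IsProjective.iff_projective]
      exact inferInstanceAs (Module.Projective A P)
    have hker := ih (LinearMap.ker f) ((hS.hasProjectiveDimensionLT_X₃_iff d hproj).1 h)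
    let T := ModuleCat.shortComplexOfCompEqZero ((LinearMap.ker f).subtype.baseChange B)
      (f.baseChange B) (by
        rw [← LinearMap.baseChange_comp, LinearMap.comp_ker_subtype, LinearMap.baseChange_zero])
    have hexact : Function.Exact ((LinearMap.ker f).subtype.lTensor B) (f.lTensor B) :=
      lTensor_exact B (LinearMap.exact_subtype_ker_map f) hf
    have hT : T.ShortExact := ModuleCat.shortComplex_shortExact T hexact
      (Module.Flat.lTensor_preserves_injective_linearMap _ (LinearMap.ker f).injective_subtype)
      (LinearMap.lTensor_surjective B hf)
    have hprojT : Projective T.X₂ := by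
      rw [← IsProjective.iff_projective]
      exact inferInstanceAs (Module.Projective B (B ⊗[A] P))
    exact (hT.hasProjectiveDimensionLT_X₃_iff d hprojT).2 hker

section Step

open Polynomial

variable {A B : Type u} [CommRing A] [CommRing B] [Algebra A B] (e : A[X] ≃ₐ[A] B)
  (M : Type u) [AddCommGroup M] [Module A M] [Module B M] [IsScalarTower A B M]

/-- For `B = A[x]`, the map `x ⊗ 1 - 1 ⊗ x` on `B ⊗[A] M`. -/
noncomputable def polynomialDifference : B ⊗[A] M →ₗ[B] B ⊗[A] M :=
  LinearMap.lsmul B _ (e X) - ((LinearMap.lsmul B M (e X)).restrictScalars A).baseChange B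

theorem polynomialDifference_tmul (b : B) (y : M) :
    polynomialDifference e M (b ⊗ₜ y) = (e X * b) ⊗ₜ y - b ⊗ₜ (e X • y) := by
  simp [polynomialDifference, smul_tmul']

theorem polynomialDifference_injective : Function.Injective (polynomialDifference e M) := by
  rw [injective_iff_map_eq_zero]
  intro t ht
  let E : B ⊗[A] M ≃ₗ[A] PolynomialModule A M :=
    (TensorProduct.congr e.symm.toLinearEquiv (LinearEquiv.refl A M)).trans
      ((PolynomialModule.polynomialTensorProductLEquivPolynomialModule A M).restrictScalars A)
  have hE : ∀ (p : A[X]) (y : M) (k : ℕ), (E (e p ⊗ₜ y)).coeff k = p.coeff k • y := by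
    intro p y k
    have : E (e p ⊗ₜ y) = p • PolynomialModule.single A 0 y := by
      simp [E, PolynomialModule.polynomialTensorProductLEquivPolynomialModule]
      rfl
    rw [this, PolynomialModule.smul_single_apply]
    simp
  have hcoeff : ∀ (s : B ⊗[A] M) (k : ℕ),
      (E (polynomialDifference e M s)).coeff (k + 1) =
        (E s).coeff k - (e X) • (E s).coeff (k + 1) := by
    intro s k
    induction s with
    | zero => simp
    | add s₁ s₂ h₁ h₂ =>
      simp only [map_add, PolynomialModule.coeff_add, Finsupp.add_apply, h₁, h₂, smul_add]
      abel
    | tmul b y =>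
      obtain ⟨p, rfl⟩ := e.surjective b
      rw [eq_sub_iff_add_eq, hE, hE, smul_comm, ← hE p (e X • y), ← coeff_X_mul, ← hE,
        ← Finsupp.add_apply, ← PolynomialModule.coeff_add, ← map_add, polynomialDifference_tmul,
        map_mul, sub_add_cancel]
  have hrec : ∀ k, (E t).coeff k = e X • (E t).coeff (k + 1) := fun k => by
    have := hcoeff t k
    rw [ht] at this
    simpa [sub_eq_zero] using this.symm
  have hpow : ∀ j k, (E t).coeff k = (e X) ^ j • (E t).coeff (k + j) := by
    intro j
    induction j with
    | zero => simp
    | succ j ih => intro k; rw [ih, hrec, smul_smul, pow_succ, add_assoc]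
  rw [← E.map_eq_zero_iff, ← PolynomialModule.coeff_eq_zero]
  ext k
  obtain ⟨N, hN⟩ := (E t).coeff.support.exists_nat_subset_range
  rw [hpow N k, Finsupp.notMem_support_iff.1, smul_zero, Finsupp.zero_apply]
  intro h
  have := Finset.mem_range.1 (hN h)
  omega

theorem tmul_sub_mem_range_polynomialDifference (p : A[X]) (y : M) :
    e p ⊗ₜ[A] y - 1 ⊗ₜ (e p • y) ∈ LinearMap.range (polynomialDifference e M) := by
  induction p using Polynomial.induction_on' generalizing y with
  | add p q hp hq =>
    rw [map_add, add_tmul, add_smul, tmul_add, add_sub_add_comm]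
    exact add_mem (hp y) (hq y)
  | monomial k a =>
    have hX : ∀ (k : ℕ) (y : M), (e X ^ k) ⊗ₜ[A] y - 1 ⊗ₜ (e X ^ k • y) ∈
        LinearMap.range (polynomialDifference e M) := by
      intro k
      induction k with
      | zero => simp
      | succ k ih =>
        intro y
        have h₁ : polynomialDifference e M ((e X ^ k) ⊗ₜ y) ∈
          LinearMap.range (polynomialDifference e M) := ⟨_, rfl⟩
        rw [polynomialDifference_tmul] at h₁
        convert add_mem h₁ (ih (e X • y)) using 1
        rw [smul_smul, ← pow_succ, pow_succ']
        abel
    rw [← C_mul_X_pow_eq_monomial, map_mul, map_pow, ← Polynomial.algebraMap_eq, AlgEquiv.commutes,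
      ← Algebra.smul_def, smul_tmul, smul_assoc, smul_comm a]
    exact hX k (a • y)

theorem polynomialDifference_exact :
    Function.Exact (polynomialDifference e M) (LinearMap.liftBaseChange B (LinearMap.id : M →ₗ[A] M))
    := by
  have hcomp : (LinearMap.liftBaseChange B (LinearMap.id : M →ₗ[A] M)) ∘ₗ
      polynomialDifference e M = 0 := by
    ext y
    simp [polynomialDifference_tmul]
  have hmem : ∀ t : B ⊗[A] M, t - 1 ⊗ₜ (LinearMap.liftBaseChange B (LinearMap.id : M →ₗ[A] M) t) ∈
      LinearMap.range (polynomialDifference e M) := by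
    intro t
    induction t with
    | zero => simp
    | add s₁ s₂ h₁ h₂ =>
      rw [map_add, tmul_add, add_sub_add_comm]
      exact add_mem h₁ h₂
    | tmul b y =>
      obtain ⟨p, rfl⟩ := e.surjective b
      simpa using tmul_sub_mem_range_polynomialDifference e M p y
  intro t
  constructor
  · intro ht
    have := hmem t
    rw [ht] at this
    simpa using this
  · rintro ⟨s, rfl⟩
    exact LinearMap.congr_fun hcomp s

theorem ModuleCat.hasProjectiveDimensionLE_succ_of_polynomial (e : A[X] ≃ₐ[A] B) (d : ℕ)
    (h : HasProjectiveDimensionLE (ModuleCat.of A M) d) :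
    HasProjectiveDimensionLE (ModuleCat.of B M) (d + 1) := by
  have : Module.Free A B := Module.Free.of_equiv e.toLinearEquiv
  have hb := ModuleCat.hasProjectiveDimensionLE_baseChange (B := B) d M h
  let T := ModuleCat.shortComplexOfCompEqZero (polynomialDifference e M)
    (LinearMap.liftBaseChange B (LinearMap.id : M →ₗ[A] M))
    (polynomialDifference_exact e M).linearMap_comp_eq_zero
  have hT : T.ShortExact := ModuleCat.shortComplex_shortExact T (polynomialDifference_exact e M)
    (polynomialDifference_injective e M) (fun y => ⟨1 ⊗ₜ y, by simp [T]⟩)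
  have : HasProjectiveDimensionLT (ModuleCat.of B (B ⊗[A] M)) (d + 1) := hb
  exact hT.hasProjectiveDimensionLT_X₃ (d + 1) hb
    (hasProjectiveDimensionLT_of_ge _ (d + 1) (d + 2) (by omega))

end Step

theorem ModuleCat.hasProjectiveDimensionLE_of_mvPolynomial {ι : Type} [Fintype ι] {A B : Type u}
    [CommRing A] [CommRing B] [Algebra A B] (e : MvPolynomial ι A ≃ₐ[A] B) (M : Type u)
    [AddCommGroup M] [Module A M] [Module B M] [IsScalarTower A B M] [Module.Projective A M] :
    HasProjectiveDimensionLE (ModuleCat.of B M) (Fintype.card ι) := by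
  refine Fintype.induction_empty_option (P := fun ι _ => ∀ (B : Type u) [CommRing B] [Algebra A B]
    (_ : MvPolynomial ι A ≃ₐ[A] B) [Module B M] [IsScalarTower A B M],
    HasProjectiveDimensionLE (ModuleCat.of B M) (Fintype.card ι)) ?_ ?_ ?_ ι B e
  · intro α β _ e₁ h B _ _ e _ _
    have := Fintype.ofEquiv β e₁.symm
    rw [← Fintype.card_congr e₁]
    convert h B ((MvPolynomial.renameEquiv A e₁).trans e)
  · intro B _ _ e _ _
    rw [Fintype.card_eq_zero, ← projective_iff_hasProjectiveDimensionLE_zero,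
      ← IsProjective.iff_projective]
    let e' : A ≃ₐ[A] B := (MvPolynomial.isEmptyAlgEquiv A PEmpty).symm.trans e
    have h' : Function.Bijective (algebraMap A B) := by
      have : ⇑(algebraMap A B) = e' := funext fun a => (e'.commutes a).symm
      rw [this]
      exact e'.bijective
    let e'' := RingEquiv.ofBijective _ h'
    have := RingHomInvPair.of_ringEquiv e''
    have := RingHomInvPair.symm (e'' : A →+* B) (e''.symm : B →+* A)
    let E : M ≃ₛₗ[(e'' : A →+* B)] M :=
      { AddEquiv.refl M with map_smul' := fun a y => (algebraMap_smul B a y).symm }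
    exact Module.Projective.of_equiv E
  · intro α _ h B _ _ e _ _
    let A' := MvPolynomial α A
    let e₁ : Polynomial A' ≃ₐ[A] B := (MvPolynomial.optionEquivLeft A α).symm.trans e
    let φ : A' →ₐ[A] B := e₁.toAlgHom.comp (Algebra.algHom A A' (Polynomial A'))
    let : Algebra A' B := φ.toRingHom.toAlgebra
    have : IsScalarTower A A' B := IsScalarTower.of_algHom φ
    let : Module A' M := Module.compHom M φ.toRingHom
    have : IsScalarTower A' B M := ⟨fun a b y => by
      rw [Algebra.smul_def, mul_smul]; rfl⟩
    have : IsScalarTower A A' M := IsScalarTower.of_algebraMap_smul fun a y => by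
      change φ (algebraMap A A' a) • y = a • y
      rw [φ.commutes, algebraMap_smul]
    have h' := h A' AlgEquiv.refl
    rw [Fintype.card_option]
    exact ModuleCat.hasProjectiveDimensionLE_succ_of_polynomial M
      (AlgEquiv.ofRingEquiv (f := e₁.toRingEquiv) (fun a => rfl)) _ h'
end BaseChange

section ExtVanishing

open CategoryTheory Abelian Limits RingTheory.Sequence TensorProduct

universe u

variable {B : Type u} [CommRing B]

theorem ModuleCat.subsingleton_ext_of_isWeaklyRegular (L N : ModuleCat.{u} B) (rs : List B)
    (hL : ∀ r ∈ rs, r ∈ Module.annihilator B L) (hN : IsWeaklyRegular N rs) :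
    ∀ i < rs.length, Subsingleton (Ext L N i) := by
  induction rs generalizing N with
  | nil => simp
  | cons r rs ih =>
    rw [isWeaklyRegular_cons_iff] at hN
    have hr := hL r List.mem_cons_self
    have key := ih (ModuleCat.of B (QuotSMulTop r N))
      (fun s hs => hL s (List.mem_cons_of_mem _ hs)) hN.2
    rintro (_ | i) hi
    · refine (Ext.addEquiv₀.trans ModuleCat.homAddEquiv).subsingleton_congr.2
        (subsingleton_of_forall_eq 0 fun f => LinearMap.ext fun y => hN.1 ?_)
      change r • f y = r • (0 : N)
      rw [← map_smul, Module.mem_annihilator.1 hr, map_zero, smul_zero]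
    · let g := AddCommGrpCat.ofHom ((Ext.mk₀ (smulShortComplex N r).f).postcomp L
        (add_zero (i + 1)))
      have mono_g : Mono g :=
        (Ext.covariant_sequence_exact₁' L hN.1.smulShortComplex_shortExact i (i + 1)
          rfl).mono_g ((AddCommGrpCat.isZero_of_iff_subsingleton.mpr
            (key i (by simpa using hi))).eq_zero_of_src _)
      have zero_g : g = 0 := Ext.postcomp_smul_id_eq_zero_of_mem_annihilator hr (i + 1)
      exact AddCommGrpCat.subsingleton_of_isZero (IsZero.of_mono_eq_zero _ zero_g)

theorem ModuleCat.subsingleton_ext_of_hasProjectiveDimensionLE (L : ModuleCat.{u} B) (rs : List B)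
    (hL : ∀ r ∈ rs, r ∈ Module.annihilator B L) (hB : IsWeaklyRegular B rs) (d : ℕ)
    (N : ModuleCat.{u} B) (hN : HasProjectiveDimensionLE N d) :
    ∀ i, i + d < rs.length → Subsingleton (Ext L N i) := by
  induction d generalizing N with
  | zero =>
    rw [← projective_iff_hasProjectiveDimensionLE_zero, ← IsProjective.iff_projective] at hN
    have : Module.Projective B N := hN
    exact L.subsingleton_ext_of_isWeaklyRegular N rs hL
      (((TensorProduct.rid B N).isWeaklyRegular_congr rs).1 hB.isWeaklyRegular_lTensor)
  | succ d ih =>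
    intro i hi
    have hS := N.shortExact_projectiveShortComplex
    have hproj : Projective N.projectiveShortComplex.X₂ := by
      rw [← IsProjective.iff_projective]
      exact Module.Projective.of_free
    have hker := ih _ ((hS.hasProjectiveDimensionLT_X₃_iff d hproj).1 hN) (i + 1) (by omega)
    have hfree : Subsingleton (Ext L N.projectiveShortComplex.X₂ i) :=
      L.subsingleton_ext_of_isWeaklyRegular N.projectiveShortComplex.X₂ rs hL
        (((TensorProduct.rid B _).isWeaklyRegular_congr rs).1 hB.isWeaklyRegular_lTensor) i
        (by omega)
    exact AddCommGrpCat.subsingleton_of_isZero <| ShortComplex.Exact.isZero_of_both_zeros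
      (Ext.covariant_sequence_exact₃' L hS i (i + 1) rfl)
      ((AddCommGrpCat.isZero_of_iff_subsingleton.mpr hfree).eq_zero_of_src _)
      ((AddCommGrpCat.isZero_of_iff_subsingleton.mpr hker).eq_zero_of_tgt _)

theorem ModuleCat.subsingleton_hom_quotient_of_subsingleton_ext (L N : ModuleCat.{u} B)
    (rs : List B) (hN : IsWeaklyRegular N rs) (h : ∀ i ≤ rs.length, Subsingleton (Ext L N i)) :
    Subsingleton (L →ₗ[B] (N ⧸ (Ideal.ofList rs • ⊤ : Submodule B N))) := by
  induction rs generalizing N with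
  | nil =>
    have := (Ext.addEquiv₀.trans ModuleCat.homAddEquiv).subsingleton_congr.1 (h 0 le_rfl)
    have e : (N ⧸ (Ideal.ofList ([] : List B) • ⊤ : Submodule B N)) ≃ₗ[B] N :=
      Submodule.quotEquivOfEqBot _ (by simp)
    exact (e.congrRight (M := L)).toEquiv.subsingleton_congr.2 this
  | cons r rs ih =>
    rw [isWeaklyRegular_cons_iff] at hN
    have := ih (ModuleCat.of B (QuotSMulTop r N)) hN.2 fun i hi =>
      AddCommGrpCat.subsingleton_of_isZero <| ShortComplex.Exact.isZero_of_both_zeros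
        (Ext.covariant_sequence_exact₃' L hN.1.smulShortComplex_shortExact i (i + 1) rfl)
        ((AddCommGrpCat.isZero_of_iff_subsingleton.mpr
          (h i (by simp; omega))).eq_zero_of_src _)
        ((AddCommGrpCat.isZero_of_iff_subsingleton.mpr
          (h (i + 1) (by simp; omega))).eq_zero_of_tgt _)
    exact ((Submodule.quotOfListConsSMulTopEquivQuotSMulTopInner N r rs).congrRight
      (M := L)).toEquiv.subsingleton_congr.2 this

/-- If `ts` is a weakly regular sequence on `N` and `y ∉ (ts) N` while every member of the
weakly `B`-regular sequence `rs` multiplies `y` into `(ts) N`, then the projective dimension of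
`N` exceeds `d` as soon as `ts.length + d < rs.length`. -/
theorem ModuleCat.not_hasProjectiveDimensionLE_of_socle (N : ModuleCat.{u} B) (rs ts : List B)
    (hB : IsWeaklyRegular B rs) (hN : IsWeaklyRegular N ts) (y : N)
    (hy : y ∉ (Ideal.ofList ts • ⊤ : Submodule B N))
    (hrs : ∀ r ∈ rs, r • y ∈ (Ideal.ofList ts • ⊤ : Submodule B N)) (d : ℕ)
    (hd : ts.length + d < rs.length) : ¬ HasProjectiveDimensionLE N d := by
  intro h
  let L := ModuleCat.of B (B ⧸ Ideal.ofList rs)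
  have hL : ∀ r ∈ rs, r ∈ Module.annihilator B L := by
    intro r hr
    change r ∈ Module.annihilator B (B ⧸ Ideal.ofList rs)
    rw [Ideal.annihilator_quotient]
    exact Ideal.subset_span hr
  have := L.subsingleton_hom_quotient_of_subsingleton_ext N ts hN fun i hi =>
    L.subsingleton_ext_of_hasProjectiveDimensionLE rs hL hB d N h i (by omega)
  let q := (Ideal.ofList ts • ⊤ : Submodule B N).mkQ
  have hker : Ideal.ofList rs ≤ LinearMap.ker (LinearMap.toSpanSingleton B _ (q y)) := by
    refine Ideal.span_le.2 fun r hr => ?_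
    simpa [q, ← Submodule.Quotient.mk_smul] using hrs r hr
  have hz : Submodule.liftQ _ _ hker = (0 : (B ⧸ Ideal.ofList rs) →ₗ[B] _) := Subsingleton.elim _ _
  have := LinearMap.congr_fun hz (Submodule.Quotient.mk 1)
  rw [Submodule.liftQ_apply] at this
  exact hy (by simpa [q] using this)

theorem MvPolynomial.isWeaklyRegular_X {R σ : Type*} [CommRing R] (l : List σ) (hl : l.Nodup) :
    IsWeaklyRegular (MvPolynomial σ R) (l.map (X : σ → MvPolynomial σ R)) := by
  rw [isWeaklyRegular_iff]
  intro i hi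
  have hi' : i < l.length := by simpa using hi
  have hI : Ideal.ofList ((l.map (X : σ → MvPolynomial σ R)).take i) =
      Ideal.span (X '' {s | s ∈ l.take i}) := by
    rw [← List.map_take, Ideal.ofList]
    congr 1
    ext; simp only [List.mem_map, Set.mem_image, Set.mem_ofPred_eq]
  rw [hI, isSMulRegular_quotient_iff_mem_of_smul_mem]
  intro f hf
  simp only [smul_eq_mul, Ideal.mul_top] at hf ⊢
  rw [mem_ideal_span_X_image] at hf ⊢
  intro s hs
  obtain ⟨p, hp, hsp⟩ := hf (s + Finsupp.single l[i] 1) (by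
    rw [mem_support_iff] at hs ⊢
    simpa [mul_comm] using hs)
  refine ⟨p, hp, ?_⟩
  have hne : l[i] ≠ p := by
    rintro rfl
    rw [Set.mem_ofPred_eq, List.mem_take_iff_getElem] at hp
    obtain ⟨j, hj, hj'⟩ := hp
    have := (hl.getElem_inj_iff).1 hj'
    omega
  simpa [Finsupp.single_apply, hne] using hsp

end ExtVanishing

section LeadingTerms

open MvPolynomial Matrix MonomialOrder

theorem MonomialOrder.degree_eq_of_coeff_ne_zero {σ R : Type*} [CommSemiring R]
    (o : MonomialOrder σ) {f : MvPolynomial σ R} {d : σ →₀ ℕ} (hd : f.coeff d ≠ 0)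
    (h : ∀ s ∈ f.support, s ≼[o] d) : o.degree f = d :=
  o.toSyn.injective (le_antisymm (o.degree_le_iff.2 h) (o.le_degree (mem_support_iff.2 hd)))

/-- The lexicographic order on monomials in the entries of an `m × n` matrix, for which the
entries decrease along the rows, the first row being the largest. -/
noncomputable def rowLex (m n : ℕ) : MonomialOrder (Fin m × Fin n) where
  syn := (MonomialOrder.lex (σ := Lex (Fin m × Fin n))).syn
  toSyn := (Finsupp.domCongr toLex).trans (MonomialOrder.lex (σ := Lex (Fin m × Fin n))).toSyn
  toSyn_monotone := fun _ _ h =>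
    (MonomialOrder.lex (σ := Lex (Fin m × Fin n))).toSyn_monotone fun i => h (ofLex i)

theorem rowLex_lt_of {m n : ℕ} {a b : Fin m × Fin n →₀ ℕ} (p : Fin m × Fin n)
    (heq : ∀ q : Fin m × Fin n, q.1 < p.1 ∨ (q.1 = p.1 ∧ q.2 < p.2) → a q = b q) (hlt : a p < b p) :
    a ≺[rowLex m n] b := by
  change (Finsupp.domCongr toLex a) ≺[MonomialOrder.lex] (Finsupp.domCongr toLex b)
  rw [MonomialOrder.lex_lt_iff, Finsupp.Lex.lt_iff]
  refine ⟨toLex p, fun q hq => ?_, hlt⟩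
  have := Prod.Lex.lt_iff.1 hq
  exact heq (ofLex q) this

variable {m n : ℕ}

/-- The exponent of the diagonal term of the minor with rows `r` and columns `c`. -/
noncomputable def diagExp {t : ℕ} (r : Fin t → Fin m) (c : Fin t → Fin n) : Fin m × Fin n →₀ ℕ :=
  ∑ i, Finsupp.single (r i, c i) 1

theorem diagExp_apply {t : ℕ} (r : Fin t → Fin m) (c : Fin t → Fin n) (p : Fin m × Fin n) :
    diagExp r c p = ∑ i, if (r i, c i) = p then 1 else 0 := by
  simp [diagExp, Finsupp.finsetSum_apply, Finsupp.single_apply]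

theorem diagExp_perm_lt {t : ℕ} {r : Fin t → Fin m} {c : Fin t → Fin n} (hr : StrictMono r)
    (hc : StrictMono c) {σ : Equiv.Perm (Fin t)} (hσ : σ ≠ 1) :
    diagExp r (c ∘ σ) ≺[rowLex m n] diagExp r c := by
  obtain ⟨i, hi, hmin⟩ : ∃ i, σ i ≠ i ∧ ∀ k < i, σ k = k := by
    have hex : ∃ i, σ i ≠ i := by
      by_contra! h
      exact hσ (Equiv.ext h)
    obtain ⟨i, hi, h⟩ := WellFounded.has_min (wellFounded_lt (α := Fin t)) {i | σ i ≠ i} hex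
    exact ⟨i, hi, fun k hk => by_contra fun hne => h k hne hk⟩
  have hlt : i < σ i := by
    refine lt_of_le_of_ne (not_lt.1 fun h => ?_) hi.symm
    exact hi (σ.injective (hmin _ h))
  refine rowLex_lt_of (r i, c i) (fun q hq => ?_) ?_
  · rw [diagExp_apply, diagExp_apply]
    refine Finset.sum_congr rfl fun k _ => ?_
    obtain ⟨q₁, q₂⟩ := q
    simp only [Prod.mk.injEq, Function.comp_apply] at hq ⊢
    rcases lt_trichotomy k i with h | rfl | h
    · rw [hmin k h]
    · have := hc hlt
      rw [if_neg, if_neg] <;> grind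
    · have := hr h
      rw [if_neg, if_neg] <;> grind
  · rw [diagExp_apply, diagExp_apply, Finset.sum_eq_zero, Finset.sum_eq_single i]
    · simp
    · intro k _ hk
      rw [if_neg]
      simp [hr.injective.eq_iff, hk]
    · simp
    · intro k _
      rw [if_neg]
      simp only [Prod.mk.injEq, hr.injective.eq_iff, Function.comp_apply, hc.injective.eq_iff]
      grind

variable (R : Type*) [CommRing R]

theorem det_mvPolynomialX_submatrix {t : ℕ} (r : Fin t → Fin m) (c : Fin t → Fin n) :
    ((mvPolynomialX (Fin m) (Fin n) R).submatrix r c).det =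
      ∑ σ : Equiv.Perm (Fin t), Equiv.Perm.sign σ • monomial (diagExp r (c ∘ σ)) (1 : R) := by
  rw [← det_transpose, det_apply]
  refine Finset.sum_congr rfl fun σ _ => ?_
  congr 1
  simp only [diagExp, transpose_apply, submatrix_apply, mvPolynomialX_apply, Function.comp_apply]
  rw [monomial_sum_one]
  rfl

theorem degree_det_submatrix [Nontrivial R] {t : ℕ} {r : Fin t → Fin m} {c : Fin t → Fin n}
    (hr : StrictMono r)
    (hc : StrictMono c) :
    (rowLex m n).degree ((mvPolynomialX (Fin m) (Fin n) R).submatrix r c).det = diagExp r c ∧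
    (rowLex m n).Monic ((mvPolynomialX (Fin m) (Fin n) R).submatrix r c).det := by
  have hcoeff : ((mvPolynomialX (Fin m) (Fin n) R).submatrix r c).det.coeff (diagExp r c) = 1 := by
    rw [det_mvPolynomialX_submatrix, coeff_sum, Finset.sum_eq_single 1]
    · simp
    · intro σ _ hσ
      rw [Units.smul_def, coeff_smul, coeff_monomial, if_neg, smul_zero]
      exact fun h => (diagExp_perm_lt hr hc hσ).ne (congrArg _ h)
    · simp
  have hdeg := (rowLex m n).degree_eq_of_coeff_ne_zero (hcoeff.trans_ne one_ne_zero) (by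
    intro s hs
    rw [det_mvPolynomialX_submatrix] at hs
    obtain ⟨σ, -, hσ⟩ := Finset.mem_biUnion.1 (support_sum hs)
    rw [mem_support_iff, Units.smul_def, coeff_smul, coeff_monomial] at hσ
    obtain rfl : diagExp r (c ∘ σ) = s := by by_contra h; simp [h] at hσ
    by_cases h : σ = 1
    · simp [h]
    · exact (diagExp_perm_lt hr hc h).le)
  refine ⟨hdeg, ?_⟩
  rw [Monic, leadingCoeff, hdeg, hcoeff]

end LeadingTerms

section Freeness

open MvPolynomial MonomialOrder

variable {σ R : Type*} [CommRing R]

/-- The polynomial ring as a polynomial ring over the polynomials in a subset of the variables. -/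
noncomputable def MvPolynomial.supportedComplEquiv (s : Set σ) :
    MvPolynomial ↥sᶜ (supported R s) ≃ₐ[supported R s] MvPolynomial σ R :=
  AlgEquiv.ofBijective (aeval fun i => X i.1) <| by
    constructor
    · have h := ((AlgebraicIndependent.iff_adjoin_image_compl sᶜ).1 (algebraicIndependent_X σ R)).2
      rw [compl_compl] at h
      exact h
    · intro p
      induction p using MvPolynomial.induction_on with
      | C a => exact ⟨C (algebraMap R _ a), by simp⟩
      | add p q hp hq =>
        obtain ⟨p, rfl⟩ := hp
        obtain ⟨q, rfl⟩ := hq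
        exact ⟨p + q, map_add _ _ _⟩
      | mul_X p i hp =>
        obtain ⟨p, rfl⟩ := hp
        by_cases hi : i ∈ s
        · refine ⟨p * C ⟨X i, Algebra.subset_adjoin ⟨i, hi, rfl⟩⟩, ?_⟩
          rw [map_mul, aeval_C]
          rfl
        · exact ⟨p * X ⟨i, hi⟩, by rw [map_mul, aeval_X]⟩

/-- The degree of a sum of nonzero polynomials with distinct degrees is one of the degrees. -/
theorem MonomialOrder.exists_degree_sum_eq (o : MonomialOrder σ) {ι : Type*} {s : Finset ι}
    (hs : s.Nonempty) {f : ι → MvPolynomial σ R} (hf : ∀ i ∈ s, f i ≠ 0)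
    (hinj : Set.InjOn (fun i => o.degree (f i)) s) :
    ∑ i ∈ s, f i ≠ 0 ∧ ∃ i ∈ s, o.degree (∑ i ∈ s, f i) = o.degree (f i) := by
  classical
  obtain ⟨i, hi, hmax⟩ := s.exists_max_image (fun i => o.toSyn (o.degree (f i))) hs
  have hc : (∑ i ∈ s, f i).coeff (o.degree (f i)) ≠ 0 := by
    rw [coeff_sum, Finset.sum_eq_single i]
    · exact o.coeff_degree_ne_zero_iff.2 (hf i hi)
    · intro j hj hji
      refine o.coeff_eq_zero_of_lt (lt_of_le_of_ne (hmax j hj) fun h => hji ?_)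
      exact hinj hj hi (o.toSyn.injective h)
    · exact fun h => (h hi).elim
  refine ⟨fun h => hc (by rw [h, coeff_zero]),
    i, hi, o.degree_eq_of_coeff_ne_zero hc fun d hd => ?_⟩
  obtain ⟨j, hj, hd⟩ := Finset.mem_biUnion.1 (support_sum hd)
  exact (o.le_degree hd).trans (hmax j hj)

theorem MvPolynomial.support_subset_of_mem_supported {s : Set σ} {p : MvPolynomial σ R}
    (hp : p ∈ supported R s) {d : σ →₀ ℕ} (hd : d ∈ p.support) {i : σ} (hi : i ∉ s) : d i = 0 := by
  by_contra h
  refine hi (mem_supported.1 hp ?_)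
  simp only [Finset.mem_coe, mem_vars_iff_mem_support]
  exact ⟨d, hd, Finsupp.mem_support_iff.2 h⟩

/-- An ideal is free over the polynomials in the variables in `s` if, for each exponent `u` in the
other variables, its leading exponents extending `u` are the multiples of a single one, which is
moreover the degree of a monic element. -/
theorem MonomialOrder.free_of_leadingExponents [IsDomain R] (o : MonomialOrder σ) (s : Set σ)
    (I : Ideal (MvPolynomial σ R))
    (h : ∀ u : σ →₀ ℕ, (∀ i ∈ s, u i = 0) → ∃ g ∈ I, o.Monic g ∧ (∀ i ∉ s, o.degree g i = u i) ∧
      ∀ f ∈ I, f ≠ 0 → (∀ i ∉ s, o.degree f i = u i) → o.degree g ≤ o.degree f) :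
    Module.Free (supported R s) I := by
  classical
  choose! g hgI hgm hgu hgle using h
  let U := {u : σ →₀ ℕ // ∀ i ∈ s, u i = 0}
  let v : U → I := fun u => ⟨g u.1, hgI u.1 u.2⟩
  have hli : LinearIndependent (supported R s) v := by
    rw [linearIndependent_iff']
    intro t c hc
    by_contra! hne
    obtain ⟨u₀, hu₀, hcu₀⟩ := hne
    have hsum : ∑ u ∈ t with c u ≠ 0, (c u : MvPolynomial σ R) * g u.1 = 0 := by
      rw [Finset.sum_filter_of_ne]
      · have := congrArg (Subtype.val) hc
        simpa [v, Algebra.smul_def, Subalgebra.smul_def] using this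
      · intro u _ hu h0
        simp [h0] at hu
    have hnz : ∀ u ∈ t.filter (c · ≠ 0), (c u : MvPolynomial σ R) ≠ 0 := by
      intro u hu h0
      exact (Finset.mem_filter.1 hu).2 (Subtype.ext h0)
    refine (o.exists_degree_sum_eq ⟨u₀, Finset.mem_filter.2 ⟨hu₀, hcu₀⟩⟩
      (fun u hu => mul_ne_zero (hnz u hu) (hgm u.1 u.2).ne_zero) ?_).1 hsum
    intro u hu u' hu' heq
    simp only [] at heq
    rw [o.degree_mul (hnz u hu) (hgm u.1 u.2).ne_zero,
      o.degree_mul (hnz u' hu') (hgm u'.1 u'.2).ne_zero] at heq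
    refine Subtype.ext (Finsupp.ext fun i => ?_)
    by_cases hi : i ∈ s
    · rw [u.2 i hi, u'.2 i hi]
    · have := DFunLike.congr_fun heq i
      rw [Finsupp.add_apply, Finsupp.add_apply, hgu u.1 u.2 i hi, hgu u'.1 u'.2 i hi,
        support_subset_of_mem_supported (c u).2 (o.degree_mem_support (hnz u hu)) hi,
        support_subset_of_mem_supported (c u').2 (o.degree_mem_support (hnz u' hu')) hi] at this
      simpa using this
  have key : ∀ (a : o.syn) (f : MvPolynomial σ R) (hf : f ∈ I), o.toSyn (o.degree f) = a →
      (⟨f, hf⟩ : I) ∈ Submodule.span (supported R s) (Set.range v) := by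
    intro a
    induction a using WellFoundedLT.induction with
    | ind a ih =>
      rintro f hf rfl
      by_cases hf0 : f = 0
      · subst hf0
        exact zero_mem _
      let u : U := ⟨(o.degree f).filter (· ∉ s), fun i hi => by simp [hi]⟩
      have hle := hgle u.1 u.2 f hf hf0 fun i hi => by simp [u, hi]
      let q : MvPolynomial σ R := monomial (o.degree f - o.degree (g u.1)) (o.leadingCoeff f)
      have hq : q ∈ supported R s := by
        rw [mem_supported]
        intro i hi
        by_contra his
        obtain ⟨d, hd, hid⟩ := (mem_vars_iff_mem_support i).1 hi
        rw [Finset.mem_singleton.1 (support_monomial_subset hd)] at hid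
        refine Finsupp.mem_support_iff.1 hid ?_
        rw [Finsupp.tsub_apply, hgu u.1 u.2 i his]
        simp [u, his]
      have hred : (⟨f, hf⟩ : I) = (⟨q, hq⟩ : supported R s) • v u +
          ⟨f - q * g u.1, I.sub_mem hf (I.mul_mem_left _ (hgI u.1 u.2))⟩ := by
        refine Subtype.ext ?_
        simp [v, Subalgebra.smul_def]
      rw [hred]
      refine add_mem (Submodule.smul_mem _ _ (Submodule.subset_span ⟨u, rfl⟩)) ?_
      have hq0 : q ≠ 0 := by simpa [q] using hf0
      have hdeg : o.degree (q * g u.1) = o.degree f := by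
        rw [o.degree_mul hq0 (hgm u.1 u.2).ne_zero, o.degree_monomial, if_neg (by simpa using hf0),
          tsub_add_cancel_of_le hle]
      have hlc : o.leadingCoeff (q * g u.1) = o.leadingCoeff f := by
        rw [leadingCoeff_mul, (hgm u.1 u.2).leadingCoeff_eq_one, mul_one, leadingCoeff_monomial]
      by_cases h0 : f - q * g u.1 = 0
      · simp only [h0]
        exact zero_mem _
      · refine ih _ (lt_of_le_of_ne ?_ ?_) _ _ rfl
        · refine o.degree_sub_le.trans ?_
          rw [hdeg, max_self]
        · intro heq
          have heq := o.toSyn.injective heq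
          refine o.coeff_degree_ne_zero_iff.2 h0 ?_
          rw [heq, coeff_sub, sub_eq_zero]
          nth_rewrite 2 [← hdeg]
          exact hlc.symm
  exact Module.Free.of_basis (Module.Basis.mk hli fun f _ => key _ f.1 f.2 rfl)

end Freeness

section CutDegree

open MvPolynomial Matrix MonomialOrder

variable {r n : ℕ}

/-- The positions `(i, j)` such that inserting `j` at place `i` into the sequence `c` yields an
increasing sequence. -/
def cutSet (c : Fin r → Fin n) : Finset (Fin (r + 1) × Fin n) :=
  {p | (∀ l : Fin r, l.castSucc < p.1 → c l < p.2) ∧ ∀ l : Fin r, p.1 ≤ l.castSucc → p.2 < c l}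

theorem mem_cutSet {c : Fin r → Fin n} {p : Fin (r + 1) × Fin n} : p ∈ cutSet c ↔
    (∀ l : Fin r, l.castSucc < p.1 → c l < p.2) ∧ ∀ l : Fin r, p.1 ≤ l.castSucc → p.2 < c l := by
  simp [cutSet]

/-- The degree of a monomial in the variables of a cut. -/
def cutDeg (c : Fin r → Fin n) (w : Fin (r + 1) × Fin n →₀ ℕ) : ℕ := ∑ p ∈ cutSet c, w p

theorem cutDeg_add (c : Fin r → Fin n) (v w : Fin (r + 1) × Fin n →₀ ℕ) :
    cutDeg c (v + w) = cutDeg c v + cutDeg c w := by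
  simp [cutDeg, Finset.sum_add_distrib]

theorem cutDeg_eq_of_eqOn {c : Fin r → Fin n} {v w : Fin (r + 1) × Fin n →₀ ℕ}
    (h : ∀ p ∈ cutSet c, v p = w p) : cutDeg c v = cutDeg c w :=
  Finset.sum_congr rfl h

theorem ne_of_mem_cutSet {c : Fin r → Fin n} {p : Fin (r + 1) × Fin n} (hp : p ∈ cutSet c)
    (l : Fin r) : c l ≠ p.2 := by
  rw [mem_cutSet] at hp
  rcases lt_or_ge l.castSucc p.1 with h | h
  · exact (hp.1 l h).ne
  · exact (hp.2 l h).ne'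

theorem eq_of_mem_cutSet {c : Fin r → Fin n} {i i' : Fin (r + 1)} {j : Fin n}
    (h : (i, j) ∈ cutSet c) (h' : (i', j) ∈ cutSet c) : i = i' := by
  wlog hlt : i < i' generalizing i i'
  · rcases lt_trichotomy i i' with h1 | h1 | h1
    · exact this h h' h1
    · exact h1
    · exact (this h' h h1).symm
  rw [mem_cutSet] at h h'
  have h1 := h.2 (i.castPred (Fin.ne_last_of_lt hlt)) (by simp)
  have h2 := h'.1 (i.castPred (Fin.ne_last_of_lt hlt)) (by simpa using hlt)
  exact absurd (h1.trans h2) (lt_irrefl _)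

theorem exists_mem_cutSet {c : Fin r → Fin n} (hc : StrictMono c) {j : Fin n}
    (hj : ∀ l, c l ≠ j) : ∃ i, (i, j) ∈ cutSet c := by
  by_cases h : ∀ l, c l < j
  · exact ⟨Fin.last r, mem_cutSet.2 ⟨fun l _ => h l, fun l hl =>
      absurd (Fin.castSucc_lt_last l) (not_lt.2 hl)⟩⟩
  · push Not at h
    obtain ⟨l, hl, hmin⟩ := WellFounded.has_min (wellFounded_lt (α := Fin r)) {l | j ≤ c l} h
    refine ⟨l.castSucc, mem_cutSet.2 ⟨fun k hk => ?_, fun k hk => ?_⟩⟩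
    · exact not_le.1 fun hle => hmin k hle (by simpa using hk)
    · exact lt_of_le_of_ne (le_trans hl (hc.monotone (by simpa using hk))) (hj k).symm

theorem strictMono_insertNth {c : Fin r → Fin n} (hc : StrictMono c) {p : Fin (r + 1) × Fin n}
    (hp : p ∈ cutSet c) : StrictMono (p.1.insertNth p.2 c : Fin (r + 1) → Fin n) := by
  rw [mem_cutSet] at hp
  intro a b hab
  induction a using p.1.succAboveCases with
  | x =>
    induction b using p.1.succAboveCases with
    | x => exact absurd hab (lt_irrefl _)
    | p l =>
      simp only [Fin.insertNth_apply_same, Fin.insertNth_apply_succAbove]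
      exact hp.2 l (Fin.lt_succAbove_iff_le_castSucc _ _ |>.1 hab)
  | p k =>
    induction b using p.1.succAboveCases with
    | x =>
      simp only [Fin.insertNth_apply_same, Fin.insertNth_apply_succAbove]
      exact hp.1 k (Fin.succAbove_lt_iff_castSucc_lt _ _ |>.1 hab)
    | p l =>
      simp only [Fin.insertNth_apply_succAbove]
      exact hc (Fin.succAbove_lt_succAbove_iff.1 hab)

theorem diagExp_insertNth (c : Fin r → Fin n) (p : Fin (r + 1) × Fin n) :
    diagExp id (p.1.insertNth p.2 c : Fin (r + 1) → Fin n) =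
      Finsupp.single p 1 + diagExp p.1.succAbove c := by
  simp [diagExp, Fin.sum_univ_succAbove _ p.1]

theorem diagExp_succAbove_apply {c : Fin r → Fin n} (i : Fin (r + 1)) {p : Fin (r + 1) × Fin n}
    (hp : p ∈ cutSet c) : diagExp i.succAbove c p = 0 := by
  rw [diagExp_apply]
  refine Finset.sum_eq_zero fun l _ => if_neg fun h => ?_
  exact ne_of_mem_cutSet hp l (congrArg Prod.snd h)

variable (R : Type*) [CommRing R]

/-- The maximal minors of the columns `c`. -/
noncomputable def cutMinor (c : Fin r → Fin n) (i : Fin (r + 1)) :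
    MvPolynomial (Fin (r + 1) × Fin n) R :=
  ((mvPolynomialX (Fin (r + 1)) (Fin n) R).submatrix i.succAbove c).det

theorem det_submatrix_insertNth (c : Fin r → Fin n) (i : Fin (r + 1)) (j : Fin n) :
    ((mvPolynomialX (Fin (r + 1)) (Fin n) R).submatrix id (i.insertNth j c)).det =
      ∑ k : Fin (r + 1), (-1) ^ (k + i : ℕ) * X (k, j) * cutMinor R c k := by
  rw [det_succ_column _ i]
  refine Finset.sum_congr rfl fun k _ => ?_
  simp only [submatrix_apply, id_eq, Fin.insertNth_apply_same, mvPolynomialX_apply, cutMinor,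
    submatrix_submatrix]
  congr 3
  ext l
  simp

/-- The substitution replacing each variable of a cut by the corresponding maximal minor. -/
noncomputable def cutSubst (c : Fin r → Fin n) :
    MvPolynomial (Fin (r + 1) × Fin n) R →ₐ[R] MvPolynomial (Fin (r + 1) × Fin n) R :=
  aeval fun p => if p ∈ cutSet c then
    ((mvPolynomialX (Fin (r + 1)) (Fin n) R).submatrix id (p.1.insertNth p.2 c)).det else X p

theorem cutSubst_X_of_mem {c : Fin r → Fin n} {p : Fin (r + 1) × Fin n} (hp : p ∈ cutSet c) :
    cutSubst R c (X p) =
      ((mvPolynomialX (Fin (r + 1)) (Fin n) R).submatrix id (p.1.insertNth p.2 c)).det := by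
  simp [cutSubst, hp]

theorem cutSubst_X_of_notMem {c : Fin r → Fin n} {p : Fin (r + 1) × Fin n} (hp : p ∉ cutSet c) :
    cutSubst R c (X p) = X p := by
  simp [cutSubst, hp]

theorem cutSubst_cutMinor (c : Fin r → Fin n) (i : Fin (r + 1)) :
    cutSubst R c (cutMinor R c i) = cutMinor R c i := by
  rw [cutMinor, AlgHom.map_det]
  congr 1
  ext1 k l
  simp only [AlgHom.mapMatrix_apply, map_apply, submatrix_apply, mvPolynomialX_apply]
  exact cutSubst_X_of_notMem R fun h => ne_of_mem_cutSet h l rfl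

/-- The polynomials which, up to the maximal minors of the columns `c`, come by `cutSubst` from
polynomials of order at least `k` in the variables of the cut. -/
def CutOrderGE (c : Fin r → Fin n) (k : ℕ) (f : MvPolynomial (Fin (r + 1) × Fin n) R) : Prop :=
  ∃ (N : ℕ) (g : MvPolynomial (Fin (r + 1) × Fin n) R), (∀ s ∈ g.support, k ≤ cutDeg c s) ∧
    cutSubst R c g = (∏ i, cutMinor R c i) ^ N * f

variable {R} {c : Fin r → Fin n} {k l : ℕ} {f f' : MvPolynomial (Fin (r + 1) × Fin n) R}

theorem le_cutDeg_of_mem_support_mul {f g : MvPolynomial (Fin (r + 1) × Fin n) R}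
    (hf : ∀ s ∈ f.support, k ≤ cutDeg c s) (hg : ∀ s ∈ g.support, l ≤ cutDeg c s) :
    ∀ s ∈ (f * g).support, k + l ≤ cutDeg c s := by
  classical
  intro s hs
  obtain ⟨a, ha, b, hb, rfl⟩ := Finset.mem_add.1 (support_mul f g hs)
  rw [cutDeg_add]
  exact add_le_add (hf a ha) (hg b hb)

theorem CutOrderGE.mul (hf : CutOrderGE R c k f) (hf' : CutOrderGE R c l f') :
    CutOrderGE R c (k + l) (f * f') := by
  obtain ⟨N, g, hg, h⟩ := hf
  obtain ⟨N', g', hg', h'⟩ := hf'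
  refine ⟨N + N', g * g', le_cutDeg_of_mem_support_mul hg hg', ?_⟩
  rw [map_mul, h, h', pow_add]
  ring

theorem cutOrderGE_of_cutSubst (g : MvPolynomial (Fin (r + 1) × Fin n) R)
    (hg : ∀ s ∈ g.support, k ≤ cutDeg c s) : CutOrderGE R c k (cutSubst R c g) :=
  ⟨0, g, hg, by simp⟩

theorem CutOrderGE.add (hf : CutOrderGE R c k f) (hf' : CutOrderGE R c k f') :
    CutOrderGE R c k (f + f') := by
  classical
  obtain ⟨N, g, hg, h⟩ := hf
  obtain ⟨N', g', hg', h'⟩ := hf'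
  refine ⟨N + N', (∏ i, cutMinor R c i) ^ N' * g + (∏ i, cutMinor R c i) ^ N * g', ?_, ?_⟩
  · intro s hs
    rcases Finset.mem_union.1 (support_add hs) with h | h
    · simpa using le_cutDeg_of_mem_support_mul (k := 0) (fun _ _ => Nat.zero_le _) hg s h
    · simpa using le_cutDeg_of_mem_support_mul (k := 0) (fun _ _ => Nat.zero_le _) hg' s h
  · simp only [map_add, map_mul, map_pow, map_prod, cutSubst_cutMinor, h, h']
    ring

theorem cutOrderGE_zero : CutOrderGE R c k 0 := ⟨0, 0, by simp⟩

theorem CutOrderGE.sum {ι : Type*} {s : Finset ι}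
    {f : ι → MvPolynomial (Fin (r + 1) × Fin n) R} (h : ∀ i ∈ s, CutOrderGE R c k (f i)) :
    CutOrderGE R c k (∑ i ∈ s, f i) :=
  Finset.sum_induction f _ (fun _ _ => CutOrderGE.add) cutOrderGE_zero h

theorem cutOrderGE_of_cutMinor_mul {i : Fin (r + 1)}
    (h : CutOrderGE R c k (cutMinor R c i * f)) : CutOrderGE R c k f := by
  have h0 : CutOrderGE R c 0 (∏ j ∈ Finset.univ.erase i, cutMinor R c j) := by
    have := cutOrderGE_of_cutSubst (R := R) (c := c) (k := 0)
      (∏ j ∈ Finset.univ.erase i, cutMinor R c j) fun _ _ => Nat.zero_le _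
    simpa only [map_prod, cutSubst_cutMinor] using this
  obtain ⟨N, g, hg, hgf⟩ := h0.mul h
  refine ⟨N + 1, g, by simpa using hg, ?_⟩
  rw [hgf, pow_succ, ← Finset.mul_prod_erase Finset.univ _ (Finset.mem_univ i)]
  ring

theorem cutOrderGE_zero_all (f : MvPolynomial (Fin (r + 1) × Fin n) R) : CutOrderGE R c 0 f := by
  induction f using MvPolynomial.induction_on with
  | C a =>
    have := cutOrderGE_of_cutSubst (c := c) (k := 0) (C a) fun _ _ => Nat.zero_le _
    rwa [← algebraMap_eq, AlgHom.commutes] at this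
  | add f g hf hg => exact hf.add hg
  | mul_X f p hf =>
    suffices h : CutOrderGE R c 0 (X p) from hf.mul h
    by_cases hp : p ∈ cutSet c
    · refine cutOrderGE_of_cutMinor_mul (i := p.1) ?_
      have := cutOrderGE_of_cutSubst (c := c) (k := 0) (X p - ∑ k ∈ Finset.univ.erase p.1,
        (-1) ^ (k + p.1 : ℕ) * X (k, p.2) * cutMinor R c k) fun _ _ => Nat.zero_le _
      convert this using 1
      rw [map_sub, cutSubst_X_of_mem R hp, map_sum, det_submatrix_insertNth,
        ← Finset.add_sum_erase Finset.univ _ (Finset.mem_univ p.1), ← two_mul, pow_mul,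
        neg_one_sq, one_pow, one_mul, mul_comm, add_sub_assoc, left_eq_add, sub_eq_zero]
      refine Finset.sum_congr rfl fun k hk => ?_
      rw [map_mul, map_mul, cutSubst_cutMinor, cutSubst_X_of_notMem R]
      · simp
      · exact fun h => Finset.ne_of_mem_erase hk (eq_of_mem_cutSet h hp)
    · have := cutOrderGE_of_cutSubst (R := R) (c := c) (k := 0) (X p) fun _ _ => Nat.zero_le _
      rwa [cutSubst_X_of_notMem R hp] at this

theorem CutOrderGE.mul_left (g : MvPolynomial (Fin (r + 1) × Fin n) R) (hf : CutOrderGE R c k f) :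
    CutOrderGE R c k (g * f) := by
  simpa using (cutOrderGE_zero_all g).mul hf

theorem cutOrderGE_one_sum (hc : StrictMono c) (j : Fin n) :
    CutOrderGE R c 1 (∑ k : Fin (r + 1), (-1) ^ (k : ℕ) * X (k, j) * cutMinor R c k) := by
  by_cases hj : ∃ l, c l = j
  · obtain ⟨l, rfl⟩ := hj
    convert cutOrderGE_zero
    have := det_submatrix_insertNth R c 0 (c l)
    simp only [Fin.val_zero, add_zero] at this
    rw [← this]
    refine det_zero_of_column_eq (Fin.succ_ne_zero l).symm fun k => ?_
    simp
  · push Not at hj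
    obtain ⟨i, hi⟩ := exists_mem_cutSet hc hj
    have h := cutOrderGE_of_cutSubst (R := R) (c := c) (k := 1) (X (i, j)) (by
      intro s hs
      rw [Finset.mem_singleton.1 (support_monomial_subset hs)]
      refine le_trans ?_ (Finset.single_le_sum (fun _ _ => Nat.zero_le _) hi)
      simp)
    rw [cutSubst_X_of_mem R hi, det_submatrix_insertNth] at h
    convert h.mul_left ((-1) ^ (i : ℕ)) using 1
    rw [Finset.mul_sum]
    refine Finset.sum_congr rfl fun k _ => ?_
    have : ((-1) ^ (i : ℕ) * (-1) ^ (i : ℕ) : MvPolynomial (Fin (r + 1) × Fin n) R) = 1 := by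
      rw [← mul_pow]; simp
    simp only [pow_add]
    linear_combination (-(-1) ^ (k : ℕ) * X (k, j) * cutMinor R c k) * this

theorem cutOrderGE_one_det (hc : StrictMono c) {f : Fin (r + 1) → Fin (r + 1)}
    (hf : Function.Injective f) (g : Fin (r + 1) → Fin n) :
    CutOrderGE R c 1 ((mvPolynomialX (Fin (r + 1)) (Fin n) R).submatrix f g).det := by
  set A := (mvPolynomialX (Fin (r + 1)) (Fin n) R).submatrix f g
  let v : Fin (r + 1) → MvPolynomial (Fin (r + 1) × Fin n) R :=
    fun i => (-1) ^ (f i : ℕ) * cutMinor R c (f i)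
  have hvA : ∀ l, CutOrderGE R c 1 ((v ᵥ* A) l) := by
    intro l
    convert cutOrderGE_one_sum hc (g l) using 1
    refine Fintype.sum_bijective f (Finite.injective_iff_bijective.1 hf) _ _ fun i => ?_
    simp only [v, A, submatrix_apply, mvPolynomialX_apply]
    ring
  have hv : v 0 * A.det = ∑ l, A.adjugate l 0 * (v ᵥ* A) l := by
    have := congrFun (vecMul_vecMul v A A.adjugate) 0
    rw [mul_adjugate, vecMul_smul, vecMul_one, Pi.smul_apply, smul_eq_mul] at this
    rw [mul_comm, ← this]
    simp only [vecMul, dotProduct, mul_comm]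
  have h : CutOrderGE R c 1 (v 0 * A.det) := hv ▸ CutOrderGE.sum fun l _ => (hvA l).mul_left _
  refine cutOrderGE_of_cutMinor_mul (i := f 0) ?_
  convert h.mul_left ((-1) ^ (f 0 : ℕ)) using 1
  rw [← mul_assoc, ← mul_assoc, ← mul_pow]
  simp

theorem cutOrderGE_of_mem_pow (hc : StrictMono c) (k : ℕ)
    (hf : f ∈ minorsIdeal (r + 1) (mvPolynomialX (Fin (r + 1)) (Fin n) R) ^ k) :
    CutOrderGE R c k f := by
  induction k generalizing f with
  | zero => exact cutOrderGE_zero_all f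
  | succ k ih =>
    rw [pow_succ] at hf
    refine Submodule.mul_induction_on hf (fun a ha b hb => (ih ha).mul ?_) fun _ _ => CutOrderGE.add
    refine Submodule.span_induction ?_ cutOrderGE_zero (fun _ _ _ _ => CutOrderGE.add)
      (fun a _ _ => CutOrderGE.mul_left a) hb
    rintro _ ⟨f, g, hf, -, rfl⟩
    exact cutOrderGE_one_det hc hf g

variable [IsDomain R]

theorem degree_cutSubst_X (hc : StrictMono c) (p : Fin (r + 1) × Fin n) :
    (rowLex (r + 1) n).Monic (cutSubst R c (X p)) ∧ (rowLex (r + 1) n).degree (cutSubst R c (X p)) =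
      Finsupp.single p 1 + if p ∈ cutSet c then diagExp p.1.succAbove c else 0 := by
  by_cases hp : p ∈ cutSet c
  · obtain ⟨h1, h2⟩ := degree_det_submatrix R strictMono_id (strictMono_insertNth hc hp)
    rw [cutSubst_X_of_mem R hp, h1, if_pos hp, diagExp_insertNth]
    exact ⟨h2, rfl⟩
  · rw [cutSubst_X_of_notMem R hp, if_neg hp, add_zero, degree_X]
    exact ⟨monic_X, rfl⟩

theorem degree_cutSubst_monomial (hc : StrictMono c) (s : Fin (r + 1) × Fin n →₀ ℕ) :
    (rowLex (r + 1) n).Monic (cutSubst R c (monomial s 1)) ∧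
      (rowLex (r + 1) n).degree (cutSubst R c (monomial s 1)) =
        s + ∑ p ∈ cutSet c, s p • diagExp p.1.succAbove c := by
  have h : cutSubst R c (monomial s 1) = ∏ p, cutSubst R c (X p) ^ s p := by
    rw [monomial_eq, C_1, one_mul, Finsupp.prod_fintype _ _ (by simp), map_prod]
    simp
  have hm := fun p => degree_cutSubst_X (R := R) hc p
  rw [h]
  refine ⟨Monic.prod fun p _ => (hm p).1.pow, ?_⟩
  rw [degree_prod fun p _ => pow_ne_zero _ (hm p).1.ne_zero]
  simp only [degree_pow, hm, nsmul_add, Finset.sum_add_distrib]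
  congr 1
  · ext p
    simp
  · simp [smul_ite, Finset.sum_ite_mem]

/-- A nonzero element of the `k`-th power of the ideal of maximal minors has a leading exponent
whose degree along each cut is at least `k`. -/
theorem le_cutDeg_degree (hc : StrictMono c) (k : ℕ)
    (hf : f ∈ minorsIdeal (r + 1) (mvPolynomialX (Fin (r + 1)) (Fin n) R) ^ k) (hf0 : f ≠ 0) :
    k ≤ cutDeg c ((rowLex (r + 1) n).degree f) := by
  obtain ⟨N, g, hg, hgf⟩ := cutOrderGE_of_mem_pow hc k hf
  have hdm : ∀ i : Fin (r + 1), (rowLex (r + 1) n).degree (cutMinor R c i) = diagExp i.succAbove c ∧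
      (rowLex (r + 1) n).Monic (cutMinor R c i) := fun i =>
    degree_det_submatrix R (Fin.strictMono_succAbove i) hc
  have hα : ∏ i, cutMinor R c i ≠ 0 := Finset.prod_ne_zero_iff.2 fun i _ => (hdm i).2.ne_zero
  have hS : ∀ (s : Fin (r + 1) × Fin n →₀ ℕ), ∀ p ∈ cutSet c,
      (s + ∑ p ∈ cutSet c, s p • diagExp p.1.succAbove c) p = s p := by
    intro s p hp
    rw [Finsupp.add_apply, Finsupp.finsetSum_apply, Finset.sum_eq_zero, add_zero]
    intro q _
    rw [Finsupp.smul_apply, diagExp_succAbove_apply _ hp, smul_zero]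
  have hg0 : g ≠ 0 := by
    rintro rfl
    rw [map_zero] at hgf
    exact mul_ne_zero (pow_ne_zero _ hα) hf0 hgf.symm
  have hsum : cutSubst R c g = ∑ s ∈ g.support, C (g.coeff s) * cutSubst R c (monomial s 1) := by
    conv_lhs => rw [g.as_sum, map_sum]
    refine Finset.sum_congr rfl fun s _ => ?_
    rw [← mul_one (coeff s g), ← C_mul_monomial, map_mul, ← algebraMap_eq, AlgHom.commutes, mul_one]
  have hterm : ∀ s ∈ g.support, C (g.coeff s) * cutSubst R c (monomial s 1) ≠ 0 ∧
      (rowLex (r + 1) n).degree (C (g.coeff s) * cutSubst R c (monomial s 1)) =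
        s + ∑ p ∈ cutSet c, s p • diagExp p.1.succAbove c := by
    intro s hs
    obtain ⟨h1, h2⟩ := degree_cutSubst_monomial (R := R) hc s
    have h3 : (C (g.coeff s) : MvPolynomial (Fin (r + 1) × Fin n) R) ≠ 0 :=
      C_ne_zero.2 (mem_support_iff.1 hs)
    exact ⟨mul_ne_zero h3 h1.ne_zero, by rw [degree_mul h3 h1.ne_zero, degree_C, zero_add, h2]⟩
  obtain ⟨-, s, hs, hdeg⟩ := (rowLex (r + 1) n).exists_degree_sum_eq
    (Finset.nonempty_iff_ne_empty.2 (mt support_eq_empty.1 hg0)) (fun s hs => (hterm s hs).1) (by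
      intro s hs s' hs' h
      simp only [(hterm s hs).2, (hterm s' hs').2] at h
      have hp : ∀ p ∈ cutSet c, s p = s' p := fun p hp => by rw [← hS s p hp, h, hS s' p hp]
      rw [Finset.sum_congr rfl fun p h => by rw [hp p h]] at h
      exact add_right_cancel h)
  rw [← hsum, hgf, (hterm s hs).2, degree_mul (pow_ne_zero _ hα) hf0, degree_pow,
    degree_prod fun i _ => (hdm i).2.ne_zero] at hdeg
  have hle := hg s hs
  rw [cutDeg_eq_of_eqOn (w := (rowLex (r + 1) n).degree f)] at hle
  · exact hle
  · intro p hp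
    rw [← hS s p hp, ← hdeg, Finsupp.add_apply, Finsupp.smul_apply, Finsupp.finsetSum_apply,
      Finset.sum_eq_zero, smul_zero, zero_add]
    intro i _
    rw [(hdm i).1, diagExp_succAbove_apply _ hp]

end CutDegree

section Cuts

open Finset

/-- A sequence `0 = D 0 < D 1 < ⋯ < D (r + 1) = n + 1`; it cuts an `(r + 1) × n` array of numbers
along the intervals `[D i, D (i + 1) - 1)` in its rows. -/
structure IsCutSeq (r n : ℕ) (D : ℕ → ℕ) : Prop where
  zero : D 0 = 0
  last : D (r + 1) = n + 1
  lt_succ : ∀ i ≤ r, D i < D (i + 1)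

/-- The total weight of an array along a cut. -/
def cutWeight (r : ℕ) (D : ℕ → ℕ) (w : ℕ → ℕ → ℕ) : ℕ :=
  ∑ i ∈ range (r + 1), ∑ j ∈ Ico (D i) (D (i + 1) - 1), w i j

/-- A chain `(i, T (i + 1) - 1)`, `i ≤ r`, of positive entries, each one being the leftmost
possible continuation. -/
structure IsGreedyChain (r n : ℕ) (w : ℕ → ℕ → ℕ) (T : ℕ → ℕ) : Prop where
  zero : T 0 = 0
  le : ∀ i ≤ r, T (i + 1) + r ≤ n + i
  lt_succ : ∀ i ≤ r, T i < T (i + 1)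
  pos : ∀ i ≤ r, 1 ≤ w i (T (i + 1) - 1)
  eq_zero : ∀ i ≤ r, ∀ j ∈ Ico (T i) (T (i + 1) - 1), w i j = 0

theorem exists_isGreedyChain {r n : ℕ} (hn : r + 1 ≤ n) (w : ℕ → ℕ → ℕ)
    (h : ∀ D, IsCutSeq r n D → 1 ≤ cutWeight r D w) : ∃ T, IsGreedyChain r n w T := by
  have key : ∀ s ≤ r + 1, ∃ T : ℕ → ℕ, T 0 = 0 ∧ ∀ i < s, T (i + 1) + r ≤ n + i ∧ T i < T (i + 1) ∧
      1 ≤ w i (T (i + 1) - 1) ∧ ∀ j ∈ Ico (T i) (T (i + 1) - 1), w i j = 0 := by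
    intro s
    induction s with
    | zero => exact fun _ => ⟨fun _ => 0, rfl, by simp⟩
    | succ s ih =>
      intro hs
      obtain ⟨T, hT0, hT⟩ := ih (by omega)
      have hTs : T s + r < n + s := by
        rcases s with _ | s
        · omega
        · have := (hT s (by omega)).1
          omega
      by_cases hex : ∃ j, T s ≤ j ∧ j + r < n + s ∧ 1 ≤ w s j
      · classical
        let j := Nat.find hex
        obtain ⟨hj₁, hj₂, hj₃⟩ : T s ≤ j ∧ j + r < n + s ∧ 1 ≤ w s j := Nat.find_spec hex
        refine ⟨fun i => if i ≤ s then T i else j + 1, by simp [hT0], fun i hi => ?_⟩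
        rcases Nat.lt_succ_iff_lt_or_eq.1 hi with hi | rfl
        · simpa [hi.le, Nat.succ_le_of_lt hi] using hT i hi
        · simp only [le_refl, if_true, Nat.not_succ_le_self, if_false, Nat.add_sub_cancel]
          refine ⟨by omega, by omega, hj₃, fun k hk => ?_⟩
          rw [mem_Ico] at hk
          have := Nat.find_min hex hk.2
          by_contra hne
          exact this ⟨hk.1, by omega, by omega⟩
      · exfalso
        let D : ℕ → ℕ := fun i => if i ≤ s then T i else n - r + i
        have hD : IsCutSeq r n D := by
          refine ⟨by simp [D, hT0], ?_, fun i hi => ?_⟩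
          · simp only [D, if_neg (show ¬ r + 1 ≤ s by omega)]
            omega
          · simp only [D]
            split_ifs with h₁ h₂ h₂
            · exact (hT i (by omega)).2.1
            · obtain rfl : i = s := by omega
              omega
            · omega
            · omega
        have := h D hD
        rw [cutWeight, sum_eq_zero] at this
        · omega
        intro i hi
        refine sum_eq_zero fun j hj => ?_
        simp only [D, mem_Ico] at hj
        split_ifs at hj with h₁ h₂ h₂
        · exact (hT i (by omega)).2.2.2 j (by rw [mem_Ico]; exact hj)
        · obtain rfl : i = s := by omega
          by_contra hne
          exact hex ⟨j, hj.1, by omega, by omega⟩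
        · omega
        · omega
  obtain ⟨T, hT0, hT⟩ := key (r + 1) le_rfl
  exact ⟨T, hT0, fun i hi => (hT i (by omega)).1, fun i hi => (hT i (by omega)).2.1,
    fun i hi => (hT i (by omega)).2.2.1, fun i hi => (hT i (by omega)).2.2.2⟩

/-- The array obtained by lowering the entries of a chain by one. -/
def removeChain (T : ℕ → ℕ) (w : ℕ → ℕ → ℕ) (i j : ℕ) : ℕ :=
  w i j - if j = T (i + 1) - 1 then 1 else 0

theorem IsGreedyChain.sum_removeChain {r n : ℕ} {w : ℕ → ℕ → ℕ} {T : ℕ → ℕ}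
    (hT : IsGreedyChain r n w T) {i : ℕ} (hi : i ≤ r) (s : Finset ℕ) :
    ∑ j ∈ s, removeChain T w i j + (if T (i + 1) - 1 ∈ s then 1 else 0) = ∑ j ∈ s, w i j := by
  rw [← sum_ite_eq' s (T (i + 1) - 1) (fun _ => 1), ← sum_add_distrib]
  refine sum_congr rfl fun j _ => ?_
  have := hT.pos i hi
  unfold removeChain
  split_ifs with h
  · subst h; omega
  · omega

theorem IsGreedyChain.le_cutWeight_removeChain {r n k : ℕ} {w : ℕ → ℕ → ℕ} {T : ℕ → ℕ}
    (hT : IsGreedyChain r n w T) (h : ∀ D, IsCutSeq r n D → k + 1 ≤ cutWeight r D w) {D : ℕ → ℕ}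
    (hD : IsCutSeq r n D) : k ≤ cutWeight r D (removeChain T w) := by
  classical
  let hit : ℕ → ℕ := fun i => if T (i + 1) - 1 ∈ Ico (D i) (D (i + 1) - 1) then 1 else 0
  have hsum : cutWeight r D (removeChain T w) + ∑ i ∈ range (r + 1), hit i = cutWeight r D w := by
    rw [cutWeight, cutWeight, ← sum_add_distrib]
    exact sum_congr rfl fun i hi => hT.sum_removeChain (by simpa [Nat.lt_succ_iff] using hi) _
  have hmem : ∀ i ≤ r, T (i + 1) - 1 ∈ Ico (D i) (D (i + 1) - 1) ↔
      D i < T (i + 1) ∧ T (i + 1) < D (i + 1) := by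
    intro i hi
    have := hT.lt_succ i hi
    have := hD.lt_succ i hi
    rw [mem_Ico]
    omega
  let H := (range (r + 1)).filter fun i => D i < T (i + 1) ∧ T (i + 1) < D (i + 1)
  rcases H.eq_empty_or_nonempty with hH | hH
  · have hzero : ∑ i ∈ range (r + 1), hit i = 0 := by
      refine sum_eq_zero fun i hi => if_neg fun hc => ?_
      rw [hmem i (by simpa [Nat.lt_succ_iff] using hi)] at hc
      exact (hH ▸ (mem_filter.2 ⟨hi, hc⟩ : i ∈ H) : i ∈ (∅ : Finset ℕ)) |> notMem_empty i
    have := h D hD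
    omega
  let a := H.min' hH
  let b := H.max' hH
  have hab : a ≤ b := H.min'_le_max' hH
  obtain ⟨har, ha⟩ := mem_filter.1 (H.min'_mem hH)
  obtain ⟨hbr, hb⟩ := mem_filter.1 (H.max'_mem hH)
  change a ∈ _ at har
  change D a < T (a + 1) ∧ T (a + 1) < D (a + 1) at ha
  change b ∈ _ at hbr
  change D b < T (b + 1) ∧ T (b + 1) < D (b + 1) at hb
  rw [mem_range] at har hbr
  let D' : ℕ → ℕ := fun i => if a < i ∧ i ≤ b then T i else D i
  have hD'D : ∀ i, i ≤ a ∨ b < i → D' i = D i := fun i hi => if_neg (by omega)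
  have hD'T : ∀ i, a < i → i ≤ b → D' i = T i := fun i h₁ h₂ => if_pos ⟨h₁, h₂⟩
  have hD' : IsCutSeq r n D' := by
    refine ⟨(hD'D 0 (by omega)).trans hD.zero, (hD'D _ (by omega)).trans hD.last, fun i hi => ?_⟩
    have h₁ := hT.lt_succ i hi
    have h₂ := hD.lt_succ i hi
    rcases lt_trichotomy i a with hia | rfl | hia
    · rwa [hD'D i (by omega), hD'D (i + 1) (by omega)]
    · rw [hD'D a (by omega)]
      rcases hab.eq_or_lt with hab | hab
      · rw [hD'D _ (by omega)]; exact h₂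
      · rw [hD'T _ (by omega) (by omega)]; exact ha.1
    · rcases lt_trichotomy i b with hib | rfl | hib
      · rwa [hD'T i hia hib.le, hD'T (i + 1) (by omega) (by omega)]
      · rw [hD'T _ hia le_rfl, hD'D (b + 1) (by omega)]
        omega
      · rwa [hD'D i (by omega), hD'D (i + 1) (by omega)]
  have hrow : ∀ i ∈ range (r + 1), ∑ j ∈ Ico (D' i) (D' (i + 1) - 1), w i j + hit i ≤
      ∑ j ∈ Ico (D i) (D (i + 1) - 1), w i j + if i = b then 1 else 0 := by
    intro i hi
    have hir : i ≤ r := by simpa [Nat.lt_succ_iff] using hi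
    have h₁ := hT.lt_succ i hir
    have h₂ := hD.lt_succ i hir
    have hhit : hit i ≤ 1 := by simp only [hit]; split_ifs <;> omega
    have hhit₀ : i < a ∨ b < i → hit i = 0 := by
      intro hab'
      refine if_neg fun hc => ?_
      rw [hmem i hir] at hc
      have hiH : i ∈ H := mem_filter.2 ⟨hi, hc⟩
      have := H.min'_le i hiH
      have := H.le_max' i hiH
      omega
    have hhit_le : hit i ≤ ∑ j ∈ Ico (D i) (D (i + 1) - 1), w i j := by
      have := hT.sum_removeChain hir (Ico (D i) (D (i + 1) - 1))
      simp only [hit]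
      omega
    rcases lt_or_ge i a with hia | hia
    · rw [hD'D i (by omega), hD'D (i + 1) (by omega), hhit₀ (Or.inl hia)]
      omega
    rcases lt_or_ge b i with hib | hib
    · rw [hD'D i (by omega), hD'D (i + 1) (by omega), hhit₀ (Or.inr hib)]
      omega
    rcases hib.eq_or_lt with rfl | hib
    · rw [if_pos rfl, hD'D (b + 1) (by omega)]
      suffices ∑ j ∈ Ico (D' b) (D (b + 1) - 1), w b j ≤ ∑ j ∈ Ico (D b) (D (b + 1) - 1), w b j by
        omega
      rcases hab.eq_or_lt with hab | hab
      · rw [hD'D b (by omega)]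
      · rw [hD'T b hab le_rfl, ← sum_Ico_consecutive (w b) (n := T (b + 1) - 1) (by omega)
          (by omega), sum_eq_zero (hT.eq_zero b hir), zero_add]
        exact sum_le_sum_of_subset (Ico_subset_Ico_left (by omega))
    · rw [if_neg hib.ne, hD'T (i + 1) (by omega) (by omega)]
      rcases hia.eq_or_lt with rfl | hia
      · rw [hD'D a (by omega), ← sum_Ico_consecutive (w a) (m := D a) (k := D (a + 1) - 1)
          (n := T (a + 1) - 1) (by omega) (by omega)]
        have : w a (T (a + 1) - 1) ≤ ∑ j ∈ Ico (T (a + 1) - 1) (D (a + 1) - 1), w a j :=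
          single_le_sum (f := w a) (fun _ _ => Nat.zero_le _) (by rw [mem_Ico]; omega)
        have := hT.pos a hir
        omega
      · rw [hD'T i hia hib.le, sum_eq_zero (hT.eq_zero i hir)]
        omega
  have htotal := sum_le_sum hrow
  rw [sum_add_distrib, sum_add_distrib, sum_ite_eq' (range (r + 1)) b,
    if_pos (by simpa using hbr)] at htotal
  change cutWeight r D' w + _ ≤ cutWeight r D w + 1 at htotal
  have := h D' hD'
  omega

end Cuts

section Chains

open MvPolynomial Matrix MonomialOrder

variable {r n : ℕ}

/-- The exponents of a monomial as an array indexed by natural numbers. -/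
def expArray (w : Fin (r + 1) × Fin n →₀ ℕ) (i j : ℕ) : ℕ :=
  if h : i < r + 1 ∧ j < n then w (⟨i, h.1⟩, ⟨j, h.2⟩) else 0

theorem expArray_apply (w : Fin (r + 1) × Fin n →₀ ℕ) (i : Fin (r + 1)) (j : Fin n) :
    expArray w i j = w (i, j) := by
  simp [expArray, i.2]

theorem IsCutSeq.mono {D : ℕ → ℕ} (hD : IsCutSeq r n D) {i j : ℕ} (hij : i ≤ j) (hj : j ≤ r + 1) :
    D i ≤ D j := by
  induction j, hij using Nat.le_induction with
  | base => exact le_rfl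
  | succ j hij ih => exact (ih (by omega)).trans (hD.lt_succ j (by omega)).le

theorem IsCutSeq.mem_cutSet_iff {D : ℕ → ℕ} (hD : IsCutSeq r n D) {c : Fin r → Fin n}
    (hc : ∀ l : Fin r, D (l + 1) = c l + 1) (i : Fin (r + 1)) (j : Fin n) :
    (i, j) ∈ cutSet c ↔ (j : ℕ) ∈ Finset.Ico (D i) (D (i + 1) - 1) := by
  rw [mem_cutSet, Finset.mem_Ico]
  constructor
  · rintro ⟨h1, h2⟩
    constructor
    · induction i using Fin.cases with
      | zero => simp [hD.zero]
      | succ l =>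
        have := h1 l l.castSucc_lt_succ
        rw [Fin.val_succ, hc l]
        exact this
    · induction i using Fin.lastCases with
      | last => simp [hD.last]
      | cast l =>
        have := h2 l le_rfl
        rw [Fin.val_castSucc, hc l]
        exact this
  · rintro ⟨h1, h2⟩
    refine ⟨fun l hl => ?_, fun l hl => ?_⟩
    · have := hD.mono (i := l + 1) (j := i) (Fin.lt_def.1 hl) (by omega)
      have := hc l
      rw [Fin.lt_def]
      simp only
      omega
    · have := hD.mono (i := i + 1) (j := l + 1) (Nat.succ_le_succ (Fin.le_def.1 hl)) (by omega)
      have := hc l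
      rw [Fin.lt_def]
      simp only
      omega

theorem IsCutSeq.cutWeight_expArray {D : ℕ → ℕ} (hD : IsCutSeq r n D) {c : Fin r → Fin n}
    (hc : ∀ l : Fin r, D (l + 1) = c l + 1) (w : Fin (r + 1) × Fin n →₀ ℕ) :
    cutWeight r D (expArray w) = cutDeg c w := by
  rw [cutWeight, cutDeg, Finset.sum_range, ← Finset.univ_inter (cutSet c), ← Finset.sum_ite_mem,
    Fintype.sum_prod_type]
  refine Finset.sum_congr rfl fun i _ => ?_
  have hsub : Finset.Ico (D i) (D (i + 1) - 1) ⊆ Finset.range n := by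
    intro j hj
    have := hD.mono (i := i + 1) (j := r + 1) (by omega) le_rfl
    have := hD.last
    simp only [Finset.mem_Ico, Finset.mem_range] at hj ⊢
    omega
  rw [← Finset.inter_eq_right.2 hsub, ← Finset.sum_ite_mem, Finset.sum_range]
  refine Finset.sum_congr rfl fun j _ => ?_
  simp only [hD.mem_cutSet_iff hc, expArray_apply]

theorem IsCutSeq.exists_cut {D : ℕ → ℕ} (hD : IsCutSeq r n D) :
    ∃ c : Fin r → Fin n, StrictMono c ∧ ∀ l : Fin r, D (l + 1) = c l + 1 := by
  have hpos : ∀ l : Fin r, 0 < D (l + 1) := fun l => by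
    have := hD.lt_succ l (by omega); omega
  have hlt : ∀ l : Fin r, D (l + 1) - 1 < n := fun l => by
    have := hD.mono (i := l + 2) (j := r + 1) (by omega) le_rfl
    have : D (l + 1) < D (l + 2) := hD.lt_succ (l + 1) (by omega)
    have := hD.last
    have := hpos l
    omega
  refine ⟨fun l => ⟨D (l + 1) - 1, hlt l⟩, fun l l' hll => ?_, fun l => ?_⟩
  · have := hD.mono (i := l + 2) (j := l' + 1) (by have := Fin.lt_def.1 hll; omega) (by omega)
    have : D (l + 1) < D (l + 2) := hD.lt_succ (l + 1) (by omega)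
    have := hpos l
    rw [Fin.lt_def]
    simp only
    omega
  · have := hpos l
    simp only
    omega

theorem exists_isCutSeq {c : Fin r → Fin n} (hc : StrictMono c) :
    ∃ D, IsCutSeq r n D ∧ ∀ l : Fin r, D (l + 1) = c l + 1 := by
  refine ⟨fun i => if i = 0 then 0 else if h : i - 1 < r then c ⟨i - 1, h⟩ + 1 else n + 1,
    ⟨by simp, by simp, fun i hi => ?_⟩, fun l => by simp⟩
  rcases Nat.eq_zero_or_pos i with rfl | h0
  · simp only [if_true, Nat.zero_add, Nat.one_ne_zero, if_false]
    split_ifs <;> omega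
  · have h1 : i - 1 < r := by omega
    simp only [h0.ne', if_false, dif_pos h1, Nat.add_sub_cancel, Nat.succ_ne_zero]
    split_ifs with h
    · have := hc (a := ⟨i - 1, h1⟩) (b := ⟨i, h⟩) (by rw [Fin.lt_def]; simp only; omega)
      rw [Fin.lt_def] at this
      omega
    · omega

/-- A monomial of degree at least `k + 1` along all cuts is divisible by the diagonal term of a
maximal minor with a quotient of degree at least `k` along all cuts. -/
theorem exists_diagExp_le (hn : r + 1 ≤ n) {k : ℕ} {w : Fin (r + 1) × Fin n →₀ ℕ}
    (h : ∀ c : Fin r → Fin n, StrictMono c → k + 1 ≤ cutDeg c w) :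
    ∃ t : Fin (r + 1) → Fin n, StrictMono t ∧ diagExp id t ≤ w ∧
      ∀ c : Fin r → Fin n, StrictMono c → k ≤ cutDeg c (w - diagExp id t) := by
  have hw : ∀ D, IsCutSeq r n D → k + 1 ≤ cutWeight r D (expArray w) := by
    intro D hD
    obtain ⟨c, hc, hDc⟩ := hD.exists_cut
    rw [hD.cutWeight_expArray hDc]
    exact h c hc
  obtain ⟨T, hT⟩ := exists_isGreedyChain hn (expArray w)
    fun D hD => (Nat.le_add_left 1 k).trans (hw D hD)
  have hTlt : ∀ i : Fin (r + 1), T (i + 1) - 1 < n := fun i => by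
    have := hT.le i (by omega)
    have := hT.lt_succ i (by omega)
    omega
  let t : Fin (r + 1) → Fin n := fun i => ⟨T (i + 1) - 1, hTlt i⟩
  have htmono : StrictMono t := by
    refine Fin.strictMono_iff_lt_succ.2 fun i => ?_
    have h1 := hT.lt_succ i (by omega)
    have h2 := hT.lt_succ (i + 1) (by omega)
    rw [Fin.lt_def]
    simp only [t, Fin.val_castSucc, Fin.val_succ]
    omega
  have hdiag : ∀ i j, diagExp id t (i, j) = if (j : ℕ) = T (i + 1) - 1 then 1 else 0 := by
    intro i j
    rw [diagExp_apply, Finset.sum_eq_single i]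
    · simp [t, Fin.ext_iff, eq_comm]
    · intro k _ hk
      simp [hk]
    · simp
  have hremove : removeChain T (expArray w) = expArray (w - diagExp id t) := by
    ext i j
    unfold removeChain expArray
    split_ifs with h1 h2 <;> simp [*]
  refine ⟨t, htmono, ?_, fun c hc => ?_⟩
  · rintro ⟨i, j⟩
    rw [hdiag]
    split_ifs with hj
    · have := hT.pos i (by omega)
      rwa [← hj, expArray_apply] at this
    · exact Nat.zero_le _
  · obtain ⟨D, hD, hDc⟩ := exists_isCutSeq hc
    have := hT.le_cutWeight_removeChain hw hD
    rwa [hremove, hD.cutWeight_expArray hDc] at this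

theorem det_submatrix_mem_minorsIdeal {R α β : Type*} [CommRing R] {t : ℕ} (A : Matrix α β R)
    {f : Fin t → α} {g : Fin t → β} (hf : Function.Injective f) (hg : Function.Injective g) :
    (A.submatrix f g).det ∈ minorsIdeal t A :=
  Ideal.subset_span ⟨f, g, hf, hg, rfl⟩

theorem exists_monic_degree_eq (R : Type*) [CommRing R] [IsDomain R] (hn : r + 1 ≤ n) (k : ℕ)
    {w : Fin (r + 1) × Fin n →₀ ℕ}
    (h : ∀ c : Fin r → Fin n, StrictMono c → k ≤ cutDeg c w) :
    ∃ g ∈ minorsIdeal (r + 1) (mvPolynomialX (Fin (r + 1)) (Fin n) R) ^ k,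
      (rowLex (r + 1) n).Monic g ∧ (rowLex (r + 1) n).degree g = w := by
  classical
  induction k generalizing w with
  | zero =>
    exact ⟨monomial w 1, by simp, monic_monomial_one, by simp [degree_monomial]⟩
  | succ k ih =>
    obtain ⟨t, ht, htw, hc⟩ := exists_diagExp_le hn h
    obtain ⟨g, hg, hgm, hgd⟩ := ih hc
    obtain ⟨h1, h2⟩ := degree_det_submatrix R strictMono_id ht
    refine ⟨g * _, ?_, hgm.mul h2, ?_⟩
    · rw [pow_succ]
      exact Ideal.mul_mem_mul hg
        (det_submatrix_mem_minorsIdeal _ Function.injective_id ht.injective)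
    · rw [degree_mul hgm.ne_zero h2.ne_zero, hgd, h1, tsub_add_cancel_of_le htw]

end Chains

section FreePowers

open MvPolynomial Matrix MonomialOrder

variable {r n : ℕ}

/-- The positions of an `(r + 1) × n` matrix outside of the band `i < j < n - r + i`. -/
def cornerSet (r n : ℕ) : Set (Fin (r + 1) × Fin n) :=
  {p | (p.2 : ℕ) ≤ p.1 ∨ n + p.1 ≤ p.2 + r}

theorem StrictMono.val_add_le {c : Fin r → Fin n} (hc : StrictMono c) {a b : Fin r} (hab : a ≤ b) :
    (c a : ℕ) + b ≤ c b + a := by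
  obtain ⟨a, ha⟩ := a
  obtain ⟨b, hb⟩ := b
  replace hab : a ≤ b := hab
  induction b, hab using Nat.le_induction with
  | base => exact le_rfl
  | succ b hab ih =>
    have h1 : (c ⟨a, ha⟩ : ℕ) + b ≤ c ⟨b, by omega⟩ + a := ih (by omega)
    have h2 : c ⟨b, by omega⟩ < c ⟨b + 1, hb⟩ := hc (Nat.lt_succ_self b)
    rw [Fin.lt_def] at h2
    change (c ⟨a, ha⟩ : ℕ) + (b + 1) ≤ c ⟨b + 1, hb⟩ + a
    omega

theorem le_of_mem_cutSet {c : Fin r → Fin n} (hc : StrictMono c) {p : Fin (r + 1) × Fin n}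
    (hp : p ∈ cutSet c) : (p.1 : ℕ) ≤ p.2 ∧ (p.2 : ℕ) + r < n + p.1 := by
  obtain ⟨⟨i, hi⟩, ⟨j, hj⟩⟩ := p
  rw [mem_cutSet] at hp
  simp only [Fin.lt_def, Fin.le_def, Fin.val_castSucc] at hp ⊢
  constructor
  · by_contra! h
    have h1 := hp.1 ⟨i - 1, by omega⟩ (by simp only; omega)
    have h2 := hc.val_add_le (a := ⟨0, by omega⟩) (b := ⟨i - 1, by omega⟩) (Nat.zero_le _)
    simp only at h1 h2
    omega
  · rcases Nat.lt_or_ge i r with h | h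
    · have h1 := hp.2 ⟨i, h⟩ le_rfl
      have h2 := hc.val_add_le (a := ⟨i, h⟩) (b := ⟨r - 1, by omega⟩) (Nat.le_sub_one_of_lt h)
      have h3 := (c ⟨r - 1, by omega⟩).2
      simp only at h1 h2
      omega
    · omega

theorem cutSet_inter_cornerSet_subsingleton {c : Fin r → Fin n} (hc : StrictMono c) :
    (↑(cutSet c) ∩ cornerSet r n).Subsingleton := by
  have hdiag : ∀ p ∈ (↑(cutSet c) ∩ cornerSet r n), (p.2 : ℕ) = p.1 := by
    rintro p ⟨hp, hp'⟩
    have := le_of_mem_cutSet hc hp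
    rcases hp' with h | h <;> omega
  suffices h : ∀ p ∈ (↑(cutSet c) ∩ cornerSet r n), ∀ q ∈ (↑(cutSet c) ∩ cornerSet r n),
      ¬ p.1 < q.1 by
    intro p hp q hq
    have h1 : p.1 = q.1 := le_antisymm (not_lt.1 (h q hq p hp)) (not_lt.1 (h p hp q hq))
    refine Prod.ext h1 (Fin.ext ?_)
    rw [hdiag p hp, hdiag q hq, h1]
  intro p hp q hq hlt
  have hp2 := hdiag p hp
  have hq2 := hdiag q hq
  rw [Fin.lt_def] at hlt
  have hpc := (mem_cutSet.1 hp.1).2 ⟨p.1, by omega⟩ le_rfl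
  have hqc := (mem_cutSet.1 hq.1).1 ⟨q.1 - 1, by omega⟩ (by
    rw [Fin.lt_def]; simp only [Fin.val_castSucc]; omega)
  have := hc.val_add_le (a := ⟨p.1, by omega⟩) (b := ⟨q.1 - 1, by omega⟩)
    (by rw [Fin.le_def]; simp only; omega)
  rw [Fin.lt_def] at hpc hqc
  simp only at this
  omega

theorem le_cutDeg_inf {c : Fin r → Fin n} (hc : StrictMono c) {k : ℕ}
    {v w : Fin (r + 1) × Fin n →₀ ℕ} (hvw : ∀ p ∉ cornerSet r n, v p = w p)
    (hv : k ≤ cutDeg c v) (hw : k ≤ cutDeg c w) : k ≤ cutDeg c (v ⊓ w) := by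
  by_cases h : ∃ p ∈ (↑(cutSet c) ∩ cornerSet r n), w p ≤ v p
  · obtain ⟨p, hp, hle⟩ := h
    rwa [cutDeg_eq_of_eqOn (w := w)]
    intro q hq
    rw [Finsupp.inf_apply, inf_eq_right]
    by_cases hq' : q ∈ cornerSet r n
    · rwa [cutSet_inter_cornerSet_subsingleton hc ⟨hq, hq'⟩ hp]
    · exact (hvw q hq').ge
  · push Not at h
    rwa [cutDeg_eq_of_eqOn (w := v)]
    intro q hq
    rw [Finsupp.inf_apply, inf_eq_left]
    by_cases hq' : q ∈ cornerSet r n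
    · exact (h q ⟨hq, hq'⟩).le
    · exact (hvw q hq').le

theorem free_minorsIdeal_pow (R : Type*) [CommRing R] [IsDomain R] (hn : r + 1 ≤ n) (k : ℕ) :
    Module.Free (supported R (cornerSet r n))
      ↥(minorsIdeal (r + 1) (mvPolynomialX (Fin (r + 1)) (Fin n) R) ^ k) := by
  classical
  refine (rowLex (r + 1) n).free_of_leadingExponents _ _ fun u hu => ?_
  let A : Set (Fin (r + 1) × Fin n →₀ ℕ) := {w | (∀ p ∉ cornerSet r n, w p = u p) ∧
    ∀ c : Fin r → Fin n, StrictMono c → k ≤ cutDeg c w}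
  have hA : A.Nonempty := by
    obtain ⟨h1, h2⟩ := degree_det_submatrix R strictMono_id (Fin.strictMono_castLE hn)
    have hmem := Ideal.mul_mem_left (minorsIdeal (r + 1)
      (mvPolynomialX (Fin (r + 1)) (Fin n) R) ^ k) (monomial u 1)
      (Ideal.pow_mem_pow (det_submatrix_mem_minorsIdeal _ Function.injective_id
        (Fin.strictMono_castLE hn).injective) k)
    have hmon : (rowLex (r + 1) n).Monic (monomial u (1 : R)) := monic_monomial_one
    refine ⟨_, fun p hp => ?_, fun c hc =>
      le_cutDeg_degree hc k hmem (hmon.mul h2.pow).ne_zero⟩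
    rw [degree_mul hmon.ne_zero h2.pow.ne_zero, degree_pow, h1, degree_monomial,
      if_neg one_ne_zero, Finsupp.add_apply, Finsupp.smul_apply, diagExp_apply,
      Finset.sum_eq_zero, smul_zero, add_zero]
    rintro i -
    refine if_neg ?_
    rintro rfl
    exact hp (Or.inl (by simp))
  obtain ⟨w, hwA, hmin⟩ := WellFounded.has_min (wellFounded_lt (α := Fin (r + 1) × Fin n →₀ ℕ)) A hA
  obtain ⟨g, hg, hgm, hgw⟩ := exists_monic_degree_eq R hn k hwA.2
  refine ⟨g, hg, hgm, by rw [hgw]; exact hwA.1, fun f hf hf0 hfu => ?_⟩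
  have hinf : w ⊓ (rowLex (r + 1) n).degree f ∈ A := by
    refine ⟨fun p hp => ?_, fun c hc => le_cutDeg_inf hc (fun p hp => ?_) (hwA.2 c hc)
      (le_cutDeg_degree hc k hf hf0)⟩
    · rw [Finsupp.inf_apply, hwA.1 p hp, hfu p hp, inf_idem]
    · rw [hwA.1 p hp, hfu p hp]
  rw [hgw]
  exact inf_eq_left.1 (eq_of_le_of_not_lt inf_le_left (hmin _ hinf))

end FreePowers

section LowerBound

open MvPolynomial Matrix MonomialOrder RingTheory.Sequence CategoryTheory

universe u

variable {r n : ℕ}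

theorem MvPolynomial.isWeaklyRegular_of_flat_supported {σ R : Type*} [CommRing R] {s : Set σ}
    (N : Type*) [AddCommGroup N] [Module (MvPolynomial σ R) N] [Module.Flat (supported R s) N]
    (l : List s) (hl : l.Nodup) :
    IsWeaklyRegular N (l.map fun i => (X i.1 : MvPolynomial σ R)) := by
  let e := (supportedEquivMvPolynomial (R := R) s).symm
  have hF : List.Forall₂ (fun (a : MvPolynomial s R) (b : supported R s) =>
      ∀ x, (e : MvPolynomial s R ≃+ supported R s) (a • x) =
        b • (e : MvPolynomial s R ≃+ supported R s) x) (l.map X) ((l.map X).map e) :=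
    List.forall₂_map_right_iff.2 (List.forall₂_same.2 fun a _ x => map_mul e a x)
  have h : IsWeaklyRegular (supported R s) ((l.map X).map e) :=
    (AddEquiv.isWeaklyRegular_congr hF).1 (isWeaklyRegular_X l hl)
  have h' : IsWeaklyRegular N ((l.map X).map e) :=
    ((TensorProduct.rid (supported R s) N).isWeaklyRegular_congr _).1 h.isWeaklyRegular_lTensor
  have h' := (isWeaklyRegular_map_algebraMap_iff (MvPolynomial σ R) N _).2 h'
  convert h' using 1
  rw [List.map_map, List.map_map]
  exact List.map_congr_left fun i _ => (supportedEquivMvPolynomial_symm_X s i).symm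

/-- The columns of the maximal minor with row `i` lying in the corners. -/
def cornerCols (hn : r + 1 ≤ n) (i l : Fin (r + 1)) : Fin n :=
  ⟨if l ≤ i then l else n - (r + 1) + l, by have := l.2; split_ifs <;> omega⟩

theorem strictMono_cornerCols (hn : r + 1 ≤ n) (i : Fin (r + 1)) :
    StrictMono (cornerCols hn i) := by
  intro a b hab
  simp only [cornerCols, Fin.lt_def, Fin.le_def] at hab ⊢
  split_ifs <;> omega

theorem cornerCols_mem (hn : r + 1 ≤ n) (i l : Fin (r + 1)) :
    (i, cornerCols hn i l) ∈ cornerSet r n := by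
  simp only [cornerSet, cornerCols, Set.mem_ofPred_eq, Fin.le_def]
  split_ifs <;> omega

theorem det_submatrix_id_mem_minorsIdeal {R β : Type*} [CommRing R] {t : ℕ}
    (A : Matrix (Fin t) β R) (g : Fin t → β) : (A.submatrix id g).det ∈ minorsIdeal t A := by
  by_cases hg : Function.Injective g
  · exact det_submatrix_mem_minorsIdeal A Function.injective_id hg
  · simp only [Function.Injective, not_forall] at hg
    obtain ⟨a, b, hab, hne⟩ := hg
    rw [det_zero_of_column_eq hne fun k => by simp [hab]]
    exact zero_mem _

theorem degree_diagExp {m n t : ℕ} (f : Fin t → Fin m) (g : Fin t → Fin n) :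
    (diagExp f g).degree = t := by
  simp [diagExp, map_sum]

theorem minorsIdeal_le_pow_idealOfVars (R : Type*) [CommRing R] (m n t : ℕ) :
    minorsIdeal t (mvPolynomialX (Fin m) (Fin n) R) ≤ idealOfVars (Fin m × Fin n) R ^ t := by
  rw [minorsIdeal, Ideal.span_le]
  rintro _ ⟨f, g, -, -, rfl⟩
  rw [SetLike.mem_coe, det_mvPolynomialX_submatrix]
  refine sum_mem fun σ _ => ?_
  rw [Units.smul_def]
  refine zsmul_mem ?_ _
  rw [mem_pow_idealOfVars_iff]
  intro s hs
  rw [Finset.mem_singleton.1 (support_monomial_subset hs), degree_diagExp]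

/-- The product of the maximal minors with columns `cornerCols`. -/
noncomputable def cornerProd (R : Type*) [CommRing R] (hn : r + 1 ≤ n) :
    MvPolynomial (Fin (r + 1) × Fin n) R :=
  ∏ i, ((mvPolynomialX (Fin (r + 1)) (Fin n) R).submatrix id (cornerCols hn i)).det

theorem prod_mem_minorsIdeal_pow (R : Type*) [CommRing R] (s : Finset (Fin (r + 1)))
    (g : Fin (r + 1) → Fin (r + 1) → Fin n) :
    ∏ i ∈ s, ((mvPolynomialX (Fin (r + 1)) (Fin n) R).submatrix id (g i)).det ∈
      minorsIdeal (r + 1) (mvPolynomialX (Fin (r + 1)) (Fin n) R) ^ s.card := by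
  rw [← Finset.prod_const]
  exact Ideal.prod_mem_prod fun i _ => det_submatrix_id_mem_minorsIdeal _ _

theorem cornerProd_mem (R : Type*) [CommRing R] (hn : r + 1 ≤ n) :
    cornerProd R hn ∈ minorsIdeal (r + 1) (mvPolynomialX (Fin (r + 1)) (Fin n) R) ^ (r + 1) := by
  simpa [cornerProd] using prod_mem_minorsIdeal_pow R Finset.univ (cornerCols hn)

theorem cornerProd_notMem (R : Type*) [CommRing R] [IsDomain R] (hn : r + 1 ≤ n) :
    cornerProd R hn ∉ idealOfVars (Fin (r + 1) × Fin n) R ^ ((r + 1) * (r + 1) + 1) := by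
  have hd := fun i => degree_det_submatrix R strictMono_id (strictMono_cornerCols hn i)
  intro h
  rw [mem_pow_idealOfVars_iff] at h
  have := h _ ((rowLex (r + 1) n).degree_mem_support
    (Finset.prod_ne_zero_iff.2 fun i _ => (hd i).2.ne_zero))
  rw [cornerProd, degree_prod fun i _ => (hd i).2.ne_zero, map_sum,
    Finset.sum_congr rfl fun i _ => by rw [(hd i).1, degree_diagExp]] at this
  simp at this

theorem X_mul_cornerProd_mem (R : Type*) [CommRing R] (hn : r + 1 ≤ n)
    (p : Fin (r + 1) × Fin n) : X p * cornerProd R hn ∈ Ideal.span (X '' cornerSet r n) *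
      minorsIdeal (r + 1) (mvPolynomialX (Fin (r + 1)) (Fin n) R) ^ (r + 1) := by
  obtain ⟨i, j⟩ := p
  set A := (mvPolynomialX (Fin (r + 1)) (Fin n) R).submatrix id (cornerCols hn i) with hA
  have hcr : A.det * X (i, j) = ∑ l, X (i, cornerCols hn i l) *
      ((mvPolynomialX (Fin (r + 1)) (Fin n) R).submatrix id
        (Function.update (cornerCols hn i) l j)).det := by
    have := congrFun (mulVec_cramer A fun k => mvPolynomialX (Fin (r + 1)) (Fin n) R k j) i
    rw [Pi.smul_apply, smul_eq_mul, mvPolynomialX_apply] at this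
    rw [← this, mulVec, dotProduct]
    refine Finset.sum_congr rfl fun l _ => ?_
    rw [cramer_apply, hA, submatrix_apply, mvPolynomialX_apply]
    congr 2
    ext1 a b
    rcases eq_or_ne b l with rfl | hb
    · simp
    · simp [hb]
  have hsplit : X (i, j) * cornerProd R hn = ∑ l, X (i, cornerCols hn i l) *
      (((mvPolynomialX (Fin (r + 1)) (Fin n) R).submatrix id
        (Function.update (cornerCols hn i) l j)).det * ∏ k ∈ Finset.univ.erase i,
          ((mvPolynomialX (Fin (r + 1)) (Fin n) R).submatrix id (cornerCols hn k)).det) := by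
    rw [cornerProd, ← Finset.mul_prod_erase Finset.univ _ (Finset.mem_univ i), ← mul_assoc,
      mul_comm (X (i, j)), hcr, Finset.sum_mul]
    exact Finset.sum_congr rfl fun l _ => mul_assoc _ _ _
  rw [hsplit]
  refine sum_mem fun l _ => Ideal.mul_mem_mul
    (Ideal.subset_span (Set.mem_image_of_mem _ (cornerCols_mem hn i l))) ?_
  rw [pow_succ']
  refine Ideal.mul_mem_mul (det_submatrix_id_mem_minorsIdeal _ _) ?_
  simpa using prod_mem_minorsIdeal_pow R (Finset.univ.erase i) (cornerCols hn)

theorem card_compl_cornerSet (hn : r + 1 ≤ n) [Fintype ↥(cornerSet r n)ᶜ] :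
    Fintype.card ↥(cornerSet r n)ᶜ = (r + 1) * (n - (r + 1)) := by
  have h : Fintype.card (Fin (r + 1) × Fin (n - (r + 1))) = (r + 1) * (n - (r + 1)) := by simp
  rw [← h]
  symm
  refine Fintype.card_congr (Equiv.ofBijective (fun p => ⟨(p.1, ⟨p.1 + 1 + p.2, by omega⟩), ?_⟩) ?_)
  · simp only [cornerSet, Set.mem_compl_iff, Set.mem_ofPred_eq]
    omega
  · constructor
    · rintro ⟨a, b⟩ ⟨a', b'⟩ h
      simp only [Subtype.mk.injEq, Prod.mk.injEq, Fin.ext_iff] at h ⊢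
      omega
    · rintro ⟨⟨i, j⟩, h⟩
      simp only [cornerSet, Set.mem_compl_iff, Set.mem_ofPred_eq] at h
      refine ⟨(i, ⟨j - (i + 1), by omega⟩), ?_⟩
      simp only [Subtype.mk.injEq, Prod.mk.injEq, Fin.ext_iff, true_and]
      omega

theorem hasProjectiveDimensionLE_minorsIdeal_pow (R : Type u) [CommRing R] [IsDomain R]
    (hn : r + 1 ≤ n) (k : ℕ) :
    HasProjectiveDimensionLE (ModuleCat.of (MvPolynomial (Fin (r + 1) × Fin n) R)
      ↥(minorsIdeal (r + 1) (mvPolynomialX (Fin (r + 1)) (Fin n) R) ^ k))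
      ((r + 1) * (n - (r + 1))) := by
  classical
  have := Fintype.ofFinite ↥(cornerSet r n)ᶜ
  have := free_minorsIdeal_pow R hn k
  rw [← card_compl_cornerSet hn]
  exact ModuleCat.hasProjectiveDimensionLE_of_mvPolynomial (supportedComplEquiv (cornerSet r n)) _

theorem not_hasProjectiveDimensionLE_minorsIdeal_pow (R : Type u) [CommRing R] [IsDomain R]
    (hn : r + 1 ≤ n) {d : ℕ} (hd : d < (r + 1) * (n - (r + 1))) :
    ¬ HasProjectiveDimensionLE (ModuleCat.of (MvPolynomial (Fin (r + 1) × Fin n) R)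
      ↥(minorsIdeal (r + 1) (mvPolynomialX (Fin (r + 1)) (Fin n) R) ^ (r + 1))) d := by
  classical
  have := Fintype.ofFinite ↥(cornerSet r n)ᶜ
  have := Fintype.ofFinite ↥(cornerSet r n)
  have := free_minorsIdeal_pow R hn (r + 1)
  set J := minorsIdeal (r + 1) (mvPolynomialX (Fin (r + 1)) (Fin n) R) with hJ
  let rs : List (MvPolynomial (Fin (r + 1) × Fin n) R) := Finset.univ.toList.map X
  let ts : List (MvPolynomial (Fin (r + 1) × Fin n) R) :=
    (Finset.univ : Finset ↥(cornerSet r n)).toList.map fun i => X i.1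
  have hts : Ideal.ofList ts = Ideal.span (X '' cornerSet r n) := by
    rw [Ideal.ofList]
    congr 1
    ext x
    simp [ts]
  have hmem : ∀ y : ↥(J ^ (r + 1)), y ∈ (Ideal.ofList ts • ⊤ :
      Submodule (MvPolynomial (Fin (r + 1) × Fin n) R) ↥(J ^ (r + 1))) ↔
      (y : MvPolynomial (Fin (r + 1) × Fin n) R) ∈ Ideal.ofList ts * J ^ (r + 1) := by
    intro y
    rw [Submodule.mem_smul_top_iff, smul_eq_mul]
  refine ModuleCat.not_hasProjectiveDimensionLE_of_socle _ rs ts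
    (isWeaklyRegular_X _ (Finset.nodup_toList _))
    (isWeaklyRegular_of_flat_supported _ _ (Finset.nodup_toList _))
    (⟨cornerProd R hn, cornerProd_mem R hn⟩ : ↥(J ^ (r + 1))) ?_ ?_ d ?_
  · refine fun h => cornerProd_notMem R hn ?_
    have h := (hmem _).1 h
    rw [pow_succ', pow_mul]
    refine Ideal.mul_mono ?_ (Ideal.pow_right_mono (minorsIdeal_le_pow_idealOfVars R _ _ _) _) h
    rw [hts]
    exact Ideal.span_mono (Set.image_subset_range _ _)
  · intro x hx
    obtain ⟨p, -, rfl⟩ := List.mem_map.1 hx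
    refine (hmem _).2 ?_
    rw [hts]
    exact X_mul_cornerProd_mem R hn p
  · have h1 := card_compl_cornerSet hn
    have h2 := Fintype.card_congr (Equiv.Set.sumCompl (cornerSet r n))
    rw [Fintype.card_sum] at h2
    simp only [rs, ts, List.length_map, Finset.length_toList, Finset.card_univ]
    omega

end LowerBound

theorem statement_8 (K : Type*) [Field K] (e : ℕ)
    (m n : ℕ) (h1m : 1 ≤ m) (hmn : m ≤ n) :
    let R := MvPolynomial (Fin e) K
    let B := MvPolynomial (Fin m × Fin n) R
    let X : Matrix (Fin m) (Fin n) B := Matrix.of fun i j => MvPolynomial.X (i, j)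
    let J : Ideal B := minorsIdeal m X
    (⨆ k : ℕ, ⨆ _ : 0 < k, pdim B ↥(J ^ k)) = ((m * (n - m) : ℕ) : ℕ∞) := by
  intro R B X J
  obtain ⟨r, rfl⟩ := Nat.exists_eq_add_of_le' h1m
  refine le_antisymm (iSup₂_le fun k _ => sInf_le ⟨_, rfl, ?_⟩)
    (le_iSup₂_of_le (r + 1) (Nat.succ_pos r) (le_sInf ?_))
  · exact exists_projectiveResolution_of_hasProjectiveDimensionLE _ _
      (h := hasProjectiveDimensionLE_minorsIdeal_pow R hmn k)
  · rintro _ ⟨d, rfl, P, hP⟩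
    by_contra h
    exact not_hasProjectiveDimensionLE_minorsIdeal_pow R hmn (Nat.cast_lt.1 (not_le.1 h))
      (P.hasProjectiveDimensionLE d hP)
end

section
/- Let K be a field, let t, m, n be integers with 1 ≤ t < m ≤ n, let X be a generic m×n matrix over K, and let F = K(X) be the fraction field of the polynomial ring K[X]. Let L be the subfield of F generated over K by all t×t minors of X. Then every entry X_{ij} of X is algebraic over L; consequently F is an algebraic extension of L. -/
/-- If the entries of the adjugate of an invertible square matrix of size at least two lie in a
subfield, then the entries of the matrix are algebraic over that subfield. -/
theorem Matrix.isAlgebraic_apply_of_adjugate_mem {K F : Type*} [Field K] [Field F] [Algebra K F]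
    (L : IntermediateField K F) {t : ℕ} (ht : 1 ≤ t)
    (A : Matrix (Fin (t + 1)) (Fin (t + 1)) F) (hdet : A.det ≠ 0)
    (hA : ∀ i j, A.adjugate i j ∈ L) (i j : Fin (t + 1)) : IsAlgebraic L (A i j) := by
  let N : Matrix (Fin (t + 1)) (Fin (t + 1)) L := Matrix.of fun i j => ⟨A.adjugate i j, hA i j⟩
  have hN : (algebraMap L F).mapMatrix N = A.adjugate := by
    ext i j
    rfl
  have hpow : IsAlgebraic L (A.det ^ t) := by
    have h : A.det ^ t = algebraMap L F N.det := by
      rw [RingHom.map_det, hN, Matrix.det_adjugate, Fintype.card_fin, Nat.add_sub_cancel]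
    rw [h]
    exact isAlgebraic_algebraMap _
  have hd : IsAlgebraic L A.det := hpow.of_pow ht
  have hadj : A.det ^ (t - 1) * A i j = algebraMap L F (N.adjugate i j) := by
    have h := Matrix.adjugate_adjugate A (by rw [Fintype.card_fin]; omega)
    rw [← hN, ← RingHom.map_adjugate, Fintype.card_fin] at h
    exact (congrFun (congrFun h i) j).symm
  have hij : A i j = (A.det ^ (t - 1))⁻¹ * algebraMap L F (N.adjugate i j) := by
    rw [← hadj, inv_mul_cancel_left₀ (pow_ne_zero _ hdet)]
  rw [hij]
  exact (hd.pow _).inv.mul (isAlgebraic_algebraMap _)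

/-- A minor of a generic matrix on distinct rows and distinct columns is nonzero. -/
theorem MvPolynomial.det_submatrix_X_ne_zero {K ι κ σ : Type*} [Field K] [Fintype ι]
    [DecidableEq ι] {f : ι → κ} {g : ι → σ} (hf : f.Injective) (hg : g.Injective) :
    ((Matrix.of fun i j => (X (i, j) : MvPolynomial (κ × σ) K)).submatrix f g).det ≠ 0 := by
  classical
  intro h
  let e : MvPolynomial (κ × σ) K →+* K :=
    eval fun p => if ∃ k, f k = p.1 ∧ g k = p.2 then 1 else 0
  have h1 : e.mapMatrix ((Matrix.of fun i j => (X (i, j) : MvPolynomial (κ × σ) K)).submatrix f g)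
      = 1 := by
    ext i j
    simp [e, Matrix.one_apply, hf.eq_iff, hg.eq_iff]
  have h2 := congrArg e h
  rw [RingHom.map_det, h1, Matrix.det_one, map_zero] at h2
  exact one_ne_zero h2

/-- The fraction field of a polynomial ring is algebraic over any intermediate field over which all
the variables are algebraic. -/
theorem MvPolynomial.isAlgebraic_fractionRing_of_X {K σ : Type*} [Field K]
    (L : IntermediateField K (FractionRing (MvPolynomial σ K)))
    (hX : ∀ s, IsAlgebraic L
      (algebraMap (MvPolynomial σ K) (FractionRing (MvPolynomial σ K)) (X s))) :
    Algebra.IsAlgebraic L (FractionRing (MvPolynomial σ K)) := by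
  have hB : ∀ p : MvPolynomial σ K, IsAlgebraic L
      (algebraMap (MvPolynomial σ K) (FractionRing (MvPolynomial σ K)) p) := by
    intro p
    induction p using MvPolynomial.induction_on with
    | C a =>
      rw [← MvPolynomial.algebraMap_eq, ← IsScalarTower.algebraMap_apply,
        IsScalarTower.algebraMap_apply K L]
      exact isAlgebraic_algebraMap _
    | add p q hp hq =>
      rw [map_add]
      exact hp.add hq
    | mul_X p s hp =>
      rw [map_mul]
      exact hp.mul (hX s)
  refine ⟨fun x => ?_⟩
  obtain ⟨a, b, -, rfl⟩ := IsFractionRing.div_surjective (A := MvPolynomial σ K) x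
  rw [div_eq_mul_inv]
  exact (hB a).mul (hB b).inv

/-- Any element of `Fin m` is the first value of an injective map from `Fin (t + 1)`, if `t < m`. -/
theorem Fin.exists_injective_apply_zero_eq {t m : ℕ} (h : t < m) (i : Fin m) :
    ∃ f : Fin (t + 1) → Fin m, f.Injective ∧ f 0 = i :=
  ⟨Equiv.swap (Fin.castLE h 0) i ∘ Fin.castLE h,
    (Equiv.injective _).comp (Fin.castLE_injective h), Equiv.swap_apply_left _ _⟩

theorem statement_11 (K : Type) [Field K]
    (t m n : ℕ) (h1t : 1 ≤ t) (htm : t < m) (hmn : m ≤ n) :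
    let B := MvPolynomial (Fin m × Fin n) K
    let F := FractionRing B
    let X : Matrix (Fin m) (Fin n) B := Matrix.of fun i j => MvPolynomial.X (i, j)
    let L : IntermediateField K F := IntermediateField.adjoin K
      {x : F | ∃ (f : Fin t → Fin m) (g : Fin t → Fin n),
        Function.Injective f ∧ Function.Injective g ∧
          x = algebraMap B F (X.submatrix f g).det}
    (∀ i j, IsAlgebraic L (algebraMap B F (X i j))) ∧ Algebra.IsAlgebraic L F := by
  intro B F X L
  have hX : ∀ i j, IsAlgebraic L (algebraMap B F (X i j)) := by
    intro i j
    obtain ⟨f, hf, rfl⟩ := Fin.exists_injective_apply_zero_eq htm i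
    obtain ⟨g, hg, rfl⟩ := Fin.exists_injective_apply_zero_eq (htm.trans_le hmn) j
    refine Matrix.isAlgebraic_apply_of_adjugate_mem L h1t
      ((algebraMap B F).mapMatrix (X.submatrix f g)) ?_ (fun i j => ?_) 0 0
    · rw [← RingHom.map_det]
      exact (map_ne_zero_iff _ (IsFractionRing.injective B F)).2
        (MvPolynomial.det_submatrix_X_ne_zero hf hg)
    · rw [← RingHom.map_adjugate, RingHom.mapMatrix_apply, Matrix.map_apply,
        Matrix.adjugate_fin_succ_eq_det_submatrix, map_mul, map_pow, map_neg, map_one]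
      refine mul_mem (pow_mem (neg_mem (one_mem L)) _) (IntermediateField.subset_adjoin K _ ?_)
      exact ⟨f ∘ j.succAbove, g ∘ i.succAbove, hf.comp Fin.succAbove_right_injective,
        hg.comp Fin.succAbove_right_injective, by rw [Matrix.submatrix_submatrix]⟩
  exact ⟨hX, MvPolynomial.isAlgebraic_fractionRing_of_X L fun s => hX s.1 s.2⟩
end
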